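/- Interior second-derivative estimate for constant-coefficient solutions on half-balls (Lemma 4.2, estimate (a)). Let a_hom ∈ ℝ^{d×d} be a constant matrix with |a_hom v| ≤ |v| and a_hom v·v ≥ λ|v|² for all v ∈ ℝ^d, with λ ∈ (0,1]. Let v be a weak solution of −∇·(a_hom∇v) = 0 in B_{R'}^+ with vanishing trace on ∂H^d_+ ∩ B_{R'}. Then for every 0 < r ≤ R'/2: r² sup_{B_r^+} |∇²v|² ≤ C(d, λ) (r/R')² ⨍_{B_{R'}^+} |∇v|² dx. -/

import Mathlib

open MeasureTheory Metric Set Filter Topology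
open scoped BigOperators ENNReal

noncomputable section

namespace HS

abbrev Ed (d : ℕ) := EuclideanSpace ℝ (Fin d)

def lastIdx (d : ℕ) (h : 0 < d) : Fin d := ⟨d - 1, Nat.sub_lt h one_pos⟩

def ebasis (d : ℕ) (i : Fin d) : Fin d → ℝ := Pi.single i 1

def dotv {d : ℕ} (v w : Fin d → ℝ) : ℝ := ∑ i, v i * w i

def norm2v {d : ℕ} (v : Fin d → ℝ) : ℝ := ∑ i, (v i)^2

def Hplus (d : ℕ) (h : 0 < d) : Set (Ed d) := {x | 0 < x (lastIdx d h)}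

def Bp (d : ℕ) (h : 0 < d) (r : ℝ) : Set (Ed d) := ball (0 : Ed d) r ∩ Hplus d h

def Bm (d : ℕ) (h : 0 < d) (r : ℝ) : Set (Ed d) := (fun x : Ed d => -x) '' Bp d h r

/-- closed-below half ball (flat boundary included) -/
def Bpc (d : ℕ) (h : 0 < d) (r : ℝ) : Set (Ed d) :=
  ball (0 : Ed d) r ∩ {x | 0 ≤ x (lastIdx d h)}

def IsTest {d : ℕ} (U : Set (Ed d)) (ζ : Ed d → ℝ) : Prop :=
  ContDiff ℝ (⊤ : ℕ∞) ζ ∧ HasCompactSupport ζ ∧ tsupport ζ ⊆ U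

def pder {d : ℕ} (ζ : Ed d → ℝ) (i : Fin d) (x : Ed d) : ℝ :=
  fderiv ℝ ζ x (EuclideanSpace.single i 1)

def gradv {d : ℕ} (ζ : Ed d → ℝ) (x : Ed d) : Fin d → ℝ := fun i => pder ζ i x

def IsWeakGradOn {d : ℕ} (U : Set (Ed d)) (u : Ed d → ℝ) (du : Ed d → Fin d → ℝ) : Prop :=
  ∀ i : Fin d, ∀ ζ : Ed d → ℝ, IsTest U ζ →
    ∫ x in U, u x * pder ζ i x = - ∫ x in U, du x i * ζ x

def MemH1 {d : ℕ} (U : Set (Ed d)) (u : Ed d → ℝ) (du : Ed d → Fin d → ℝ) : Prop :=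
  IsWeakGradOn U u du ∧ IntegrableOn (fun x => (u x)^2) U ∧
    IntegrableOn (fun x => norm2v (du x)) U

def UniformlyElliptic {d : ℕ} (a : Ed d → Matrix (Fin d) (Fin d) ℝ) (lam : ℝ) : Prop :=
  ∀ᵐ x : Ed d, ∀ v : Fin d → ℝ,
    norm2v ((a x).mulVec v) ≤ norm2v v ∧ lam * norm2v v ≤ dotv ((a x).mulVec v) v

def MatElliptic {d : ℕ} (A : Matrix (Fin d) (Fin d) ℝ) (lam : ℝ) : Prop :=
  ∀ v : Fin d → ℝ, norm2v (A.mulVec v) ≤ norm2v v ∧ lam * norm2v v ≤ dotv (A.mulVec v) v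

/-- weak form of `−∇·(a F) = 0` on `U` -/
def WeakDivFree {d : ℕ} (a : Ed d → Matrix (Fin d) (Fin d) ℝ) (U : Set (Ed d))
    (F : Ed d → Fin d → ℝ) : Prop :=
  ∀ ζ : Ed d → ℝ, IsTest U ζ → ∫ x in U, dotv ((a x).mulVec (F x)) (gradv ζ x) = 0

/-- weak form of `−∇·S = g` on `U` -/
def WeakNegDivEq {d : ℕ} (U : Set (Ed d)) (S : Ed d → Fin d → ℝ) (g : Ed d → ℝ) : Prop :=
  ∀ ζ : Ed d → ℝ, IsTest U ζ →
    ∫ x in U, dotv (S x) (gradv ζ x) = ∫ x in U, g x * ζ x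

def ext0 (d : ℕ) (h : 0 < d) (u : Ed d → ℝ) : Ed d → ℝ :=
  fun x => if 0 < x (lastIdx d h) then u x else 0

def ext0v (d : ℕ) (h : 0 < d) (du : Ed d → Fin d → ℝ) : Ed d → Fin d → ℝ :=
  fun x => if 0 < x (lastIdx d h) then du x else 0

/-- flux of the corrected coordinate function: `e_i + ∇φ_i` -/
def corrFlux {d : ℕ} (i : Fin d) (dφ : Ed d → Fin d → ℝ) : Ed d → Fin d → ℝ :=
  fun x l => ebasis d i l + dφ x l

/-- `e_j · (a(e_i + ∇φ_i) − a_hom e_i)`, the flux correction -/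
def fluxCorr {d : ℕ} (a : Ed d → Matrix (Fin d) (Fin d) ℝ) (A : Matrix (Fin d) (Fin d) ℝ)
    (i j : Fin d) (dφ : Ed d → Fin d → ℝ) : Ed d → ℝ :=
  fun x => (a x).mulVec (corrFlux i dφ x) j - A.mulVec (ebasis d i) j

/-- a whole-space corrector `(φ,σ)` for the coefficient field `a`,
with homogenized matrix `A` -/
structure Corrector (d : ℕ) (a : Ed d → Matrix (Fin d) (Fin d) ℝ)
    (A : Matrix (Fin d) (Fin d) ℝ) where
  φ : Fin d → Ed d → ℝ
  dφ : Fin d → Ed d → Fin d → ℝ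
  σ : Fin d → Fin d → Fin d → Ed d → ℝ
  dσ : Fin d → Fin d → Fin d → Ed d → Fin d → ℝ
  φ_grad : ∀ i, IsWeakGradOn univ (φ i) (dφ i)
  σ_grad : ∀ i j k, IsWeakGradOn univ (σ i j k) (dσ i j k)
  φ_loc : ∀ i (R : ℝ), IntegrableOn (fun x => (φ i x)^2) (ball 0 R) ∧
    IntegrableOn (fun x => norm2v (dφ i x)) (ball 0 R)
  σ_loc : ∀ i j k (R : ℝ), IntegrableOn (fun x => (σ i j k x)^2) (ball 0 R) ∧
    IntegrableOn (fun x => norm2v (dσ i j k x)) (ball 0 R)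
  σ_skew : ∀ i j k x, σ i j k x = - σ i k j x
  φ_eq : ∀ i, WeakDivFree a univ (corrFlux i (dφ i))
  σ_eq : ∀ i j, ∀ ζ : Ed d → ℝ, IsTest univ ζ →
    - ∫ x, dotv (fun k => σ i j k x) (gradv ζ x) = ∫ x, fluxCorr a A i j (dφ i) x * ζ x

def corrNorm2 {d : ℕ} (φ : Fin d → Ed d → ℝ) (σ : Fin d → Fin d → Fin d → Ed d → ℝ)
    (x : Ed d) : ℝ :=
  ∑ i, (φ i x)^2 + ∑ i, ∑ j, ∑ k, (σ i j k x)^2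

/-- the sublinearity measure `δ_R` of the whole-space corrector -/
def deltaW {d : ℕ} (φ : Fin d → Ed d → ℝ) (σ : Fin d → Fin d → Fin d → Ed d → ℝ)
    (R : ℝ) : ℝ :=
  (1/R) * Real.sqrt (⨍ x in ball (0 : Ed d) R, corrNorm2 φ σ x)

/-- the sublinearity measure `δ^H_r` of the half-space-adapted corrector -/
def deltaH (d : ℕ) (h : 0 < d) (φH : Fin d → Ed d → ℝ)
    (σH : Fin d → Fin d → Fin d → Ed d → ℝ) (φfull : Fin d → Ed d → ℝ) (r : ℝ) : ℝ :=
  (1/r) * Real.sqrt ((⨍ x in Bp d h r, corrNorm2 φH σH x) +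
    ⨍ x in Bm d h r, ∑ i ∈ Finset.univ.erase (lastIdx d h), (φfull i x)^2)

/-- the half-space-adapted tilt-excess -/
def excess (d : ℕ) (h : 0 < d) (du : Ed d → Fin d → ℝ) (dφHd : Ed d → Fin d → ℝ)
    (r : ℝ) : ℝ :=
  ⨅ b : ℝ, ⨍ x in Bp d h r,
    norm2v (fun i => du x i - b * (ebasis d (lastIdx d h) i + dφHd x i))

/-- tangential projection of a vector `v` at the point `x` of a sphere centered at `0` -/
def tanProj (d : ℕ) (x : Ed d) (v : Fin d → ℝ) : Fin d → ℝ :=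
  fun i => v i - ((∑ j, x j * v j) / (∑ j, (x j)^2)) * x i

/-- a half-space-adapted corrector on `B_R^+` -/
structure HalfCorrectorOn (d : ℕ) (h : 0 < d) (a : Ed d → Matrix (Fin d) (Fin d) ℝ)
    (A : Matrix (Fin d) (Fin d) ℝ) (R : ℝ) where
  φH : Fin d → Ed d → ℝ
  dφH : Fin d → Ed d → Fin d → ℝ
  σH : Fin d → Fin d → Fin d → Ed d → ℝ
  φfull : Fin d → Ed d → ℝ
  dφfull : Fin d → Ed d → Fin d → ℝ
  σ_skew : ∀ i j k x, σH i j k x = - σH i k j x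
  φ_mem : ∀ i, MemH1 (Bp d h R) (φH i) (dφH i)
  σ_mem : ∀ i j k, IntegrableOn (fun x => (σH i j k x)^2) (Bp d h R)
  φ_eq : ∀ i, WeakDivFree a (Bp d h R) (corrFlux i (dφH i))
  σ_eq : ∀ i j, ∀ ζ : Ed d → ℝ, IsTest (Bp d h R) ζ →
    - ∫ x in Bp d h R, dotv (fun k => σH i j k x) (gradv ζ x)
      = ∫ x in Bp d h R, fluxCorr a A i j (dφH i) x * ζ x
  trace_d : IsWeakGradOn (ball 0 R) (ext0 d h (φH (lastIdx d h)))
    (ext0v d h (dφH (lastIdx d h)))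
  full_restrict : ∀ i, i ≠ lastIdx d h → ∀ x ∈ Bp d h R,
    φH i x = φfull i x ∧ dφH i x = dφfull i x
  full_grad : ∀ i, i ≠ lastIdx d h → IsWeakGradOn (ball 0 R) (φfull i) (dφfull i)
  full_eq : ∀ i, i ≠ lastIdx d h → WeakDivFree a (ball 0 R) (corrFlux i (dφfull i))
  full_mem : ∀ i, i ≠ lastIdx d h → IntegrableOn (fun x => (φfull i x)^2) (ball 0 R)


/-- `R_n := r₀ 2^n = 2^{m₀} 2^n` (paper scale `r₀ 2^{m+1}` for `m = n − 1`) -/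
def Rscale (m0 n : ℕ) : ℝ := (2:ℝ)^m0 * 2^n

/-- The cutoff construction of Section 2.1: a dyadic base radius `r₀ = 2^{m₀}`, a radial
partition of unity `η`, slab cutoffs `S` with widths `L`, and the Lax–Milgram solutions
`φm` of `−∇·(a∇φm) = ∇·(a∇(χ φ_d))` on the half-space with zero boundary values.
The natural index `n` corresponds to the paper's index `m = n − 1 ≥ −1`. -/
structure CutoffData (d : ℕ) (h : 0 < d) (a : Ed d → Matrix (Fin d) (Fin d) ℝ)
    (φd : Ed d → ℝ) (dφd : Ed d → Fin d → ℝ) where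
  m0 : ℕ
  L : ℕ → ℝ
  η : ℕ → Ed d → ℝ
  S : ℕ → Ed d → ℝ
  φm : ℕ → Ed d → ℝ
  dφm : ℕ → Ed d → Fin d → ℝ
  η_smooth : ∀ n, ContDiff ℝ (⊤ : ℕ∞) (η n)
  η_range : ∀ n x, 0 ≤ η n x ∧ η n x ≤ 1
  η_radial : ∀ n x y, ‖x‖ = ‖y‖ → η n x = η n y
  η_partition : ∀ x, ∑' n, η n x = 1
  η0_supp : tsupport (η 0) ⊆ closedBall (0 : Ed d) ((2:ℝ)^m0)
  η_supp : ∀ n, 1 ≤ n →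
    tsupport (η n) ⊆ {x : Ed d | Rscale m0 n / 4 ≤ ‖x‖ ∧ ‖x‖ ≤ Rscale m0 n}
  η_grad : ∀ n, 1 ≤ n → ∀ x, norm2v (gradv (η n) x) ≤ (8 / Rscale m0 n)^2
  L_pos : ∀ n, 0 < L n
  L_le : ∀ n, L n ≤ Rscale m0 n
  S_smooth : ∀ n, ContDiff ℝ (⊤ : ℕ∞) (S n)
  S_slab : ∀ n x y, x (lastIdx d h) = y (lastIdx d h) → S n x = S n y
  S_range : ∀ n x, 0 ≤ S n x ∧ S n x ≤ 1
  S_one : ∀ n x, |x (lastIdx d h)| ≤ L n → S n x = 1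
  S_zero : ∀ n x, 2 * L n ≤ |x (lastIdx d h)| → S n x = 0
  S_grad : ∀ n x, norm2v (gradv (S n) x) ≤ (2 / L n)^2
  φm_trace : ∀ n, IsWeakGradOn univ (ext0 d h (φm n)) (ext0v d h (dφm n))
  φm_energy : ∀ n, IntegrableOn (fun x => norm2v (dφm n x)) (Hplus d h)
  φm_loc : ∀ n (r : ℝ), IntegrableOn (fun x => (φm n x)^2) (Bp d h r)
  φm_eq : ∀ n, ∀ ζ : Ed d → ℝ, IsTest (Hplus d h) ζ →
    ∫ x in Hplus d h, dotv ((a x).mulVec (fun i =>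
        dφm n x i + (η n x * S n x) * dφd x i
          + φd x * pder (fun y => η n y * S n y) i x)) (gradv ζ x) = 0

variable {d : ℕ} {h : 0 < d} {a : Ed d → Matrix (Fin d) (Fin d) ℝ}
  {φd : Ed d → ℝ} {dφd : Ed d → Fin d → ℝ}

/-- `φ^H_{d,M} = φ_d − (∑ φ_m + ∑ χ_m φ_d)`; the Lean index `M` corresponds to the
paper's `M + 1`, so the sum ranges over the paper indices `−1, …, M`. -/
def phiHdM (C : CutoffData d h a φd dφd) (M : ℕ) : Ed d → ℝ :=
  fun x => φd x - ((∑ n ∈ Finset.range (M+1), C.φm n x)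
    + ∑ n ∈ Finset.range (M+1), (C.η n x * C.S n x) * φd x)

/-- the gradient of `φ^H_{d,M}` -/
def dphiHdM (C : CutoffData d h a φd dφd) (M : ℕ) : Ed d → Fin d → ℝ :=
  fun x i => dφd x i - ((∑ n ∈ Finset.range (M+1), C.dφm n x i)
    + ∑ n ∈ Finset.range (M+1), ((C.η n x * C.S n x) * dφd x i
        + φd x * pder (fun y => C.η n y * C.S n y) i x))

/-- The auxiliary Poisson problems of Step 2: `v n j M` is the Lax–Milgram solution of
`−Δ v = ∇·(η_n x_j a(∇φ^H_{d,M} − ∇φ_d))` on the half-space, with homogeneous Dirichlet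
boundary conditions for `j ≠ d` and homogeneous Neumann boundary conditions for `j = d`. -/
structure VData (d : ℕ) (h : 0 < d) (a : Ed d → Matrix (Fin d) (Fin d) ℝ)
    (φd : Ed d → ℝ) (dφd : Ed d → Fin d → ℝ) (C : CutoffData d h a φd dφd) where
  v : ℕ → Fin d → ℕ → Ed d → ℝ
  dv : ℕ → Fin d → ℕ → Ed d → Fin d → ℝ
  v_trace : ∀ n j M, j ≠ lastIdx d h →
    IsWeakGradOn univ (ext0 d h (v n j M)) (ext0v d h (dv n j M))
  v_neumann_grad : ∀ n M, IsWeakGradOn (Hplus d h) (v n (lastIdx d h) M)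
    (dv n (lastIdx d h) M)
  v_energy : ∀ n j M, IntegrableOn (fun x => norm2v (dv n j M x)) (Hplus d h)
  v_loc : ∀ n j M (r : ℝ), IntegrableOn (fun x => (v n j M x)^2) (Bp d h r)
  v_eq_dir : ∀ n (j : Fin d) M, j ≠ lastIdx d h → ∀ ζ : Ed d → ℝ, IsTest (Hplus d h) ζ →
    ∫ x in Hplus d h, dotv (dv n j M x) (gradv ζ x)
      = - ∫ x in Hplus d h, (C.η n x * x j) *
          dotv ((a x).mulVec (fun l => dphiHdM C M x l - dφd x l)) (gradv ζ x)
  v_eq_neu : ∀ n M, ∀ ζ : Ed d → ℝ, IsTest univ ζ →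
    ∫ x in Hplus d h, dotv (dv n (lastIdx d h) M x) (gradv ζ x)
      = - ∫ x in Hplus d h, (C.η n x * x (lastIdx d h)) *
          dotv ((a x).mulVec (fun l => dphiHdM C M x l - dφd x l)) (gradv ζ x)
  v_norm : ∀ n M, ⨍ x in Bp d h ((2:ℝ)^C.m0), v n (lastIdx d h) M x = 0

/-- `b^n_{j,M}`: zero for the paper index `n = −1` (Lean index `0`), and otherwise the
gradient of `v^n_{j,M}` at the origin (taken within the closed half-space). -/
def bvec {C : CutoffData d h a φd dφd} (V : VData d h a φd dφd C)
    (n : ℕ) (j : Fin d) (M : ℕ) : Fin d → ℝ :=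
  if n = 0 then (fun _ => 0) else
    fun i => fderivWithin ℝ (V.v n j M) {x : Ed d | 0 ≤ x (lastIdx d h)} 0
      (EuclideanSpace.single i 1)

/-- reflection across the hyperplane `{x_d = 0}` -/
def reflectMap (d : ℕ) (h : 0 < d) (x : Ed d) : Ed d :=
  (WithLp.equiv 2 (Fin d → ℝ)).symm
    (fun i => if i = lastIdx d h then -(x i) else x i)

/-- the reflected coefficient matrix `ã_hom` -/
def reflectMat (d : ℕ) (h : 0 < d) (A : Matrix (Fin d) (Fin d) ℝ) :
    Matrix (Fin d) (Fin d) ℝ :=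
  fun i j => if (i = lastIdx d h ∧ j ≠ lastIdx d h) ∨ (i ≠ lastIdx d h ∧ j = lastIdx d h)
    then -(A i j) else A i j

/-- quadratic form of a matrix -/
def qf {d : ℕ} (M : Matrix (Fin d) (Fin d) ℝ) (x : Ed d) : ℝ := dotv x.ofLp (M.mulVec x.ofLp)

lemma norm2v_eq {d : ℕ} (x : Ed d) : norm2v x.ofLp = ‖x‖^2 := by
  rw [EuclideanSpace.real_norm_sq_eq]; rfl

structure MF {d : ℕ} (h0 : 0 < d) (lam : ℝ) (S M : Matrix (Fin d) (Fin d) ℝ) : Prop where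
  Ss : ∀ i j, S i j = S j i
  Ms : ∀ i j, M i j = M j i
  SM : S * M = 1
  Sb : ∀ i j, |S i j| ≤ 1
  Sd : lam ≤ S (lastIdx d h0) (lastIdx d h0)
  qlow : ∀ x : Ed d, lam / d^2 * ‖x‖^2 ≤ qf M x
  qup : ∀ x : Ed d, qf M x ≤ ‖x‖^2 / lam
  Mb : ∀ (x : Ed d) j, |M.mulVec x.ofLp j| ≤ ‖x‖ / lam

lemma norm2v_single {d : ℕ} (j : Fin d) : norm2v (Pi.single j (1:ℝ)) = 1 := by
  unfold norm2v
  rw [Finset.sum_eq_single j] <;> simp +contextual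

lemma sq_le_norm2v {d : ℕ} (w : Fin d → ℝ) (j : Fin d) : (w j)^2 ≤ norm2v w :=
  Finset.single_le_sum (f := fun i => (w i)^2) (fun _ _ => sq_nonneg _) (Finset.mem_univ j)

lemma norm2v_nonneg {d : ℕ} (w : Fin d → ℝ) : 0 ≤ norm2v w :=
  Finset.sum_nonneg fun _ _ => sq_nonneg _

lemma dotv_sq_le {d : ℕ} (a b : Fin d → ℝ) : (dotv a b)^2 ≤ norm2v a * norm2v b :=
  Finset.sum_mul_sq_le_sq_mul_sq _ _ _

lemma mat_facts {d : ℕ} (h0 : 0 < d) {lam : ℝ} (hlam0 : 0 < lam)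
    {A : Matrix (Fin d) (Fin d) ℝ} (hA : MatElliptic A lam) :
    ∃ S M : Matrix (Fin d) (Fin d) ℝ, MF h0 lam S M ∧ ∀ i j, S i j = (A i j + A j i)/2 := by
  set S : Matrix (Fin d) (Fin d) ℝ := fun i j => (A i j + A j i)/2 with hS
  have hAb : ∀ i j, |A i j| ≤ 1 := by
    intro i j
    have h1 := (hA (Pi.single j 1)).1
    rw [norm2v_single] at h1
    have h2 := (sq_le_norm2v (A.mulVec (Pi.single j 1)) i).trans h1
    simp at h2
    exact h2
  have hSb : ∀ i j, |S i j| ≤ 1 := by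
    intro i j
    have h1 := abs_le.1 (hAb i j)
    have h2 := abs_le.1 (hAb j i)
    simp only [hS]
    rw [abs_le]; constructor <;> linarith
  have hSdot : ∀ v, dotv (S.mulVec v) v = dotv (A.mulVec v) v := by
    intro v
    have e1 : dotv (A.mulVec v) v = ∑ i, ∑ j, A i j * v j * v i := by
      simp [dotv, Matrix.mulVec, dotProduct, Finset.sum_mul]
    have e2 : dotv (A.mulVec v) v = ∑ i, ∑ j, A j i * v j * v i := by
      rw [e1, Finset.sum_comm]
      refine Finset.sum_congr rfl fun i _ => Finset.sum_congr rfl fun j _ => by ring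
    have e3 : dotv (S.mulVec v) v = ∑ i, ∑ j, (A i j * v j * v i + A j i * v j * v i)/2 := by
      simp only [dotv, Matrix.mulVec, dotProduct, Finset.sum_mul, hS]
      refine Finset.sum_congr rfl fun i _ => Finset.sum_congr rfl fun j _ => by ring
    rw [e3]
    simp only [← Finset.sum_div, Finset.sum_add_distrib]
    rw [← e1, ← e2]; ring
  have hell : ∀ v, lam * norm2v v ≤ dotv (S.mulVec v) v := fun v => by
    rw [hSdot]; exact (hA v).2
  have hu : IsUnit S.det := by
    rw [isUnit_iff_ne_zero]
    intro hdet
    obtain ⟨v, hv, hv0⟩ := Matrix.exists_mulVec_eq_zero_iff.2 hdet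
    have h1 := hell v
    rw [hv0] at h1
    simp only [dotv, Pi.zero_apply, zero_mul, Finset.sum_const_zero] at h1
    have h2 : norm2v v = 0 := le_antisymm (by nlinarith) (norm2v_nonneg v)
    apply hv
    funext j
    have h3 := sq_le_norm2v v j
    rw [h2] at h3
    simpa using pow_eq_zero_iff (n := 2) (by norm_num) |>.1 (le_antisymm h3 (sq_nonneg _))
  have hSM : S * S⁻¹ = 1 := Matrix.mul_nonsing_inv _ hu
  have hSt : S.transpose = S := by
    ext i j; rw [Matrix.transpose_apply]; simp only [hS]; ring
  have hMt : (S⁻¹).transpose = S⁻¹ := by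
    rw [Matrix.transpose_nonsing_inv, hSt]
  have key : ∀ x : Fin d → ℝ, S.mulVec (S⁻¹.mulVec x) = x := by
    intro x; rw [Matrix.mulVec_mulVec, hSM, Matrix.one_mulVec]
  have hq : ∀ x : Ed d, lam * norm2v (S⁻¹.mulVec x.ofLp) ≤ qf S⁻¹ x := by
    intro x
    have := hell (S⁻¹.mulVec x.ofLp)
    rwa [key] at this
  have hMx : ∀ x : Ed d, norm2v (S⁻¹.mulVec x.ofLp) ≤ ‖x‖^2/lam^2 := by
    intro x
    set N := norm2v (S⁻¹.mulVec x.ofLp) with hN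
    have hN0 : 0 ≤ N := norm2v_nonneg _
    have h1 := hq x
    have h2 : (qf S⁻¹ x)^2 ≤ ‖x‖^2 * N := by
      rw [← norm2v_eq]; exact dotv_sq_le _ _
    rw [le_div_iff₀ (by positivity)]
    rcases hN0.eq_or_lt with h | h
    · rw [← h]; simp
    · have h3 : (lam * N)^2 ≤ (qf S⁻¹ x)^2 := by gcongr
      have h4 : (N * lam^2) * N ≤ ‖x‖^2 * N := by nlinarith
      exact le_of_mul_le_mul_right h4 h
  refine ⟨S, S⁻¹, ⟨?_, ?_, hSM, hSb, ?_, ?_, ?_, ?_⟩, fun i j => rfl⟩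
  · intro i j; simp [hS]; ring
  · intro i j; exact congrFun (congrFun hMt j) i
  · have := hell (Pi.single (lastIdx d h0) 1)
    rw [norm2v_single] at this
    simpa [dotv, Pi.single_apply] using this
  · intro x
    have h1 := hq x
    have h2 : ‖x‖^2 ≤ d^2 * norm2v (S⁻¹.mulVec x.ofLp) := by
      rw [← norm2v_eq]
      conv_lhs => rw [← key x.ofLp]
      set u := S⁻¹.mulVec x.ofLp
      have : ∀ i, (S.mulVec u i)^2 ≤ d * norm2v u := by
        intro i
        have := dotv_sq_le (fun j => S i j) u
        refine this.trans ?_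
        refine mul_le_mul_of_nonneg_right ?_ (norm2v_nonneg u)
        calc norm2v (fun j => S i j) ≤ ∑ j : Fin d, (1:ℝ) := by
              refine Finset.sum_le_sum fun j _ => ?_
              have := hSb i j
              rw [← sq_abs]; nlinarith [abs_nonneg (S i j)]
          _ = d := by simp
      calc norm2v (S.mulVec u) ≤ ∑ j : Fin d, (d * norm2v u) := Finset.sum_le_sum fun j _ => this j
        _ = _ := by simp; ring
    have hd : (0:ℝ) < d := by exact_mod_cast h0
    calc lam / d^2 * ‖x‖^2 ≤ lam / d^2 * (d^2 * norm2v (S⁻¹.mulVec x.ofLp)) := by gcongr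
      _ = lam * norm2v (S⁻¹.mulVec x.ofLp) := by field_simp
      _ ≤ _ := h1
  · intro x
    have h2 : (qf S⁻¹ x)^2 ≤ ‖x‖^2 * norm2v (S⁻¹.mulVec x.ofLp) := by
      rw [← norm2v_eq]; exact dotv_sq_le _ _
    have h3 := hMx x
    refine le_trans (le_abs_self _) (abs_le_of_sq_le_sq ?_ (by positivity))
    calc (qf S⁻¹ x)^2 ≤ ‖x‖^2 * (‖x‖^2/lam^2) := h2.trans (by gcongr)
      _ = (‖x‖^2/lam)^2 := by ring
  · intro x j
    have h2 := (sq_le_norm2v (S⁻¹.mulVec x.ofLp) j).trans (hMx x)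
    refine abs_le_of_sq_le_sq ?_ (by positivity)
    rw [div_pow]; exact h2

lemma cont_coord {d : ℕ} (l : Fin d) : Continuous (fun x : Ed d => x l) := by fun_prop

lemma Bp_open {d : ℕ} (h0 : 0 < d) (R : ℝ) : IsOpen (Bp d h0 R) :=
  isOpen_ball.inter (isOpen_lt continuous_const (cont_coord _))

lemma Bp_sub {d : ℕ} (h0 : 0 < d) (R : ℝ) : Bp d h0 R ⊆ Bpc d h0 R :=
  fun x hx => ⟨hx.1, le_of_lt (show 0 < x (lastIdx d h0) from hx.2)⟩

lemma Hc_convex {d : ℕ} (l : Fin d) : Convex ℝ {x : Ed d | 0 ≤ x l} := by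
  intro x hx y hy a b ha hb _
  simp only [mem_ofPred_eq, PiLp.add_apply, PiLp.smul_apply, smul_eq_mul] at *
  positivity

lemma Bpc_convex {d : ℕ} (h0 : 0 < d) (R : ℝ) : Convex ℝ (Bpc d h0 R) :=
  (convex_ball _ _).inter (Hc_convex _)

lemma Bp_nonempty {d : ℕ} (h0 : 0 < d) {R : ℝ} (hR : 0 < R) : (Bp d h0 R).Nonempty := by
  refine ⟨EuclideanSpace.single (lastIdx d h0) (R/2), ?_, ?_⟩
  · simp [abs_of_pos hR]; linarith
  · simp [Hplus, hR]

lemma Bpc_unique {d : ℕ} (h0 : 0 < d) {R : ℝ} (hR : 0 < R) : UniqueDiffOn ℝ (Bpc d h0 R) :=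
  uniqueDiffOn_convex (Bpc_convex h0 R)
    ((Bp_nonempty h0 hR).mono (interior_maximal (Bp_sub h0 R) (Bp_open h0 R)))

lemma Hc_unique {d : ℕ} (h0 : 0 < d) :
    UniqueDiffOn ℝ {x : Ed d | 0 ≤ x (lastIdx d h0)} :=
  uniqueDiffOn_convex (Hc_convex _)
    ((Bp_nonempty h0 one_pos).mono (interior_maximal
      (fun _ hx => (Bp_sub h0 1 hx).2) (Bp_open h0 1)))

lemma exists_pder_ext {d : ℕ} (h0 : 0 < d) {R : ℝ} (hR : 0 < R) {g : Ed d → ℝ}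
    (hg : ContDiffOn ℝ (⊤ : ℕ∞) g (Bpc d h0 R)) (i : Fin d) :
    ∃ p : Ed d → ℝ, ContDiffOn ℝ (⊤ : ℕ∞) p (Bpc d h0 R) ∧
      ∀ x ∈ Bp d h0 R, p x = pder g i x := by
  refine ⟨fun x => fderivWithin ℝ g (Bpc d h0 R) x (EuclideanSpace.single i 1), ?_, ?_⟩
  · exact (hg.fderivWithin (Bpc_unique h0 hR) (by simp)).clm_apply contDiffOn_const
  · intro x hx
    have : Bpc d h0 R ∈ 𝓝 x := mem_of_superset ((Bp_open h0 R).mem_nhds hx) (Bp_sub h0 R)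
    simp only [pder, fderivWithin_of_mem_nhds this]

lemma hyper_null {d : ℕ} (l : Fin d) : ∀ᵐ x : Ed d, x l ≠ 0 := by
  let W : Submodule ℝ (Ed d) := LinearMap.ker (EuclideanSpace.proj (𝕜 := ℝ) l : Ed d →L[ℝ] ℝ).toLinearMap
  have hW : W ≠ ⊤ := by
    intro h
    have : EuclideanSpace.single l (1:ℝ) ∈ W := by rw [h]; trivial
    simp [W] at this
  have := Measure.addHaar_submodule (volume : Measure (Ed d)) W hW
  rw [ae_iff]
  convert this using 2
  ext x; simp [W]

lemma half_div {d : ℕ} (h0 : 0 < d) {R R1 : ℝ} (hR : 0 < R) (hR1 : R1 < R) {f : Ed d → ℝ}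
    (hf : ContDiffOn ℝ 1 f (Bpc d h0 R))
    (hb : ∀ x ∈ ball (0 : Ed d) R, x (lastIdx d h0) = 0 → f x = 0)
    (hz : ∀ x ∈ Bpc d h0 R, R1 < ‖x‖ → f x = 0) (i : Fin d) :
    ∫ x in Bp d h0 R, pder f i x = 0 := by
  set l := lastIdx d h0 with hl
  set Hc : Set (Ed d) := {x : Ed d | 0 ≤ x l} with hHc
  set g : Ed d → ℝ := (Bpc d h0 R).indicator f with hg
  have gz : ∀ x : Ed d, R1 < ‖x‖ → g x = 0 := by
    intro x hx
    by_cases h : x ∈ Bpc d h0 R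
    · rw [hg, indicator_of_mem h, hz x h hx]
    · rw [hg, indicator_of_notMem h]
  have gz2 : ∀ x : Ed d, x l ≤ 0 → g x = 0 := by
    intro x hx
    by_cases h : x ∈ Bpc d h0 R
    · rw [hg, indicator_of_mem h]; exact hb x h.1 (le_antisymm hx h.2)
    · rw [hg, indicator_of_notMem h]
  have gout : ∀ x : Ed d, R1 < ‖x‖ → g =ᶠ[𝓝 x] fun _ => 0 := by
    intro x hx
    filter_upwards [(isOpen_lt continuous_const continuous_norm).mem_nhds hx] with z hz'
    exact gz z hz'
  have gC : ContDiffOn ℝ 1 g Hc := by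
    intro x hx
    by_cases hxR : ‖x‖ < R
    · have hxB : x ∈ Bpc d h0 R := ⟨by simpa using hxR, hx⟩
      have h1 : ContDiffWithinAt ℝ 1 g (Bpc d h0 R) x :=
        (hf x hxB).congr (fun y hy => indicator_of_mem hy _) (indicator_of_mem hxB _)
      refine h1.mono_of_mem_nhdsWithin ?_
      rw [Bpc, inter_comm]
      exact inter_mem_nhdsWithin _ (isOpen_ball.mem_nhds (by simpa using hxR))
    · exact ((contDiffAt_const (c := (0:ℝ))).congr_of_eventuallyEq
        (gout x (by linarith))).contDiffWithinAt
  obtain ⟨C, hC⟩ : ∃ C : NNReal, ∀ x ∈ Hc, ‖fderivWithin ℝ g Hc x‖₊ ≤ C := by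
    have hcont := gC.continuousOn_fderivWithin (Hc_unique h0) le_rfl
    have hcl : IsClosed Hc := isClosed_le continuous_const (cont_coord _)
    have hK : IsCompact (closedBall (0 : Ed d) R ∩ Hc) :=
      (isCompact_closedBall _ _).inter_right hcl
    obtain ⟨C, hC⟩ := hK.exists_bound_of_continuousOn (hcont.mono inter_subset_right)
    refine ⟨Real.toNNReal (max C 0), fun x hx => ?_⟩
    rw [← NNReal.coe_le_coe, Real.coe_toNNReal _ (le_max_right _ _), coe_nnnorm]
    by_cases hxR : ‖x‖ ≤ R
    · exact (hC x ⟨by simpa using hxR, hx⟩).trans (le_max_left _ _)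
    · have : fderivWithin ℝ g Hc x = 0 := by
        rw [Filter.EventuallyEq.fderivWithin_eq
          ((gout x (by linarith)).filter_mono nhdsWithin_le_nhds) (gz x (by linarith))]
        simp
      rw [this]; simp
  have hLon : LipschitzOnWith C g Hc :=
    (Hc_convex l).lipschitzOnWith_of_nnnorm_fderivWithin_le
      (gC.differentiableOn (by simp)) hC
  have aux : ∀ x y : Ed d, 0 ≤ x l → y l < 0 → |g x| ≤ C * dist x y := by
    intro x y hx hy
    set x0 : Ed d := x - EuclideanSpace.single l (x l) with hx0
    have hx0l : x0 l = 0 := by simp [hx0]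
    have h1 := hLon.dist_le_mul x hx x0 (by simp [hHc, hx0l])
    rw [gz2 x0 hx0l.le, Real.dist_eq, sub_zero] at h1
    refine h1.trans ?_
    gcongr
    have e1 : dist x x0 = |x l| := by
      rw [dist_eq_norm, hx0]; simp
    rw [e1, abs_of_nonneg hx, dist_eq_norm]
    have h2 : |(x - y) l| ≤ ‖x - y‖ := by
      simpa using PiLp.norm_apply_le (x - y) l
    have h3 : x l - y l ≤ ‖x - y‖ := (le_abs_self _).trans (by simpa using h2)
    linarith
  have hLip : LipschitzWith C g := by
    refine LipschitzWith.of_dist_le_mul fun x y => ?_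
    rcases lt_or_ge (x l) 0 with hx | hx <;> rcases lt_or_ge (y l) 0 with hy | hy
    · rw [gz2 x hx.le, gz2 y hy.le]; simp; positivity
    · rw [gz2 x hx.le, dist_comm, Real.dist_eq, sub_zero, dist_comm]; exact aux y x hy hx
    · rw [gz2 y hy.le, Real.dist_eq, sub_zero]; exact aux x y hx hy
    · exact hLon.dist_le_mul x hx y hy
  let η : ContDiffBump (0 : Ed d) := ⟨R, R+1, hR, by linarith⟩
  obtain ⟨D, hD⟩ := ContDiff.lipschitzWith_of_hasCompactSupport η.hasCompactSupport
    (η.contDiff (n := 1)) one_ne_zero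
  have key := hLip.integral_lineDeriv_mul_eq (μ := (volume : Measure (Ed d))) hD
    η.hasCompactSupport (EuclideanSpace.single i 1)
  have e2 : ∀ x, lineDeriv ℝ η x (-EuclideanSpace.single i 1) * g x = 0 := by
    intro x
    by_cases hx : ‖x‖ < R
    · have : (η : Ed d → ℝ) =ᶠ[𝓝 x] fun _ => 1 := by
        filter_upwards [isOpen_ball.mem_nhds (show x ∈ ball (0:Ed d) R by simpa using hx)] with z hz'
        exact η.one_of_mem_closedBall (ball_subset_closedBall hz')
      rw [Filter.EventuallyEq.lineDeriv_eq this]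
      simp [lineDeriv]
    · rw [gz x (by linarith)]; simp
  simp only [e2, integral_zero] at key
  rw [← integral_indicator (Bp_open h0 R).measurableSet, ← key]
  refine integral_congr_ae ?_
  filter_upwards [hyper_null l] with x hx
  by_cases hxB : x ∈ Bp d h0 R
  · have hn := (Bp_open h0 R).mem_nhds hxB
    have : g =ᶠ[𝓝 x] f := by
      filter_upwards [hn] with z hz'
      exact indicator_of_mem (Bp_sub h0 R hz') _
    rw [indicator_of_mem hxB, this.lineDeriv_eq, η.one_of_mem_closedBall
      (ball_subset_closedBall hxB.1), mul_one]
    have hd : DifferentiableAt ℝ f x :=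
      (hf.differentiableOn (by simp)).differentiableAt (mem_of_superset hn (Bp_sub h0 R))
    rw [hd.lineDeriv_eq_fderiv]; rfl
  · rw [indicator_of_notMem hxB]
    have : g =ᶠ[𝓝 x] fun _ => 0 := by
      rcases lt_or_gt_of_ne hx with h | h
      · filter_upwards [(isOpen_lt (cont_coord l) continuous_const).mem_nhds h] with z hz'
        exact gz2 z (le_of_lt hz')
      · refine gout x ?_
        by_contra hcon
        exact hxB ⟨by simp; linarith, h⟩
    rw [this.lineDeriv_eq]
    simp [lineDeriv]

lemma pder_mul {d : ℕ} {f g : Ed d → ℝ} {x : Ed d} (hf : DifferentiableAt ℝ f x)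
    (hg : DifferentiableAt ℝ g x) (i : Fin d) :
    pder (fun y => f y * g y) i x = pder f i x * g x + f x * pder g i x := by
  unfold pder
  rw [fderiv_fun_mul hf hg]
  simp; ring

lemma pder_sub {d : ℕ} {f g : Ed d → ℝ} {x : Ed d} (hf : DifferentiableAt ℝ f x)
    (hg : DifferentiableAt ℝ g x) (i : Fin d) :
    pder (fun y => f y - g y) i x = pder f i x - pder g i x := by
  unfold pder
  rw [fderiv_fun_sub hf hg]
  simp

lemma two_le_inf : (2 : WithTop ℕ∞) ≤ ((⊤ : ℕ∞) : WithTop ℕ∞) :=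
  WithTop.coe_le_coe.2 (le_top : (2:ℕ∞) ≤ ⊤)

lemma pder_congr {d : ℕ} {f g : Ed d → ℝ} {U : Set (Ed d)} (hU : IsOpen U)
    (h : ∀ x ∈ U, f x = g x) (i : Fin d) {x : Ed d} (hx : x ∈ U) : pder f i x = pder g i x := by
  unfold pder
  have : f =ᶠ[𝓝 x] g := by filter_upwards [hU.mem_nhds hx] with z hz using h z hz
  rw [this.fderiv_eq]

lemma pder_contDiff {d : ℕ} {f : Ed d → ℝ} (hf : ContDiff ℝ (⊤ : ℕ∞) f) (i : Fin d) :
    ContDiff ℝ (⊤ : ℕ∞) (fun x => pder f i x) :=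
  (hf.fderiv_right (m := ((⊤ : ℕ∞) : WithTop ℕ∞)) (by simp)).clm_apply contDiff_const

lemma diffAt_of {d : ℕ} {h0 : 0 < d} {R : ℝ} {f : Ed d → ℝ}
    (hf : ContDiffOn ℝ (⊤ : ℕ∞) f (Bpc d h0 R)) {x : Ed d} (hx : x ∈ Bp d h0 R) :
    DifferentiableAt ℝ f x :=
  (hf.differentiableOn (by simp)).differentiableAt
    (mem_of_superset ((Bp_open h0 R).mem_nhds hx) (Bp_sub h0 R))

lemma pder_vanish {d : ℕ} {h0 : 0 < d} {R R1 : ℝ} {f : Ed d → ℝ}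
    (hz : ∀ x ∈ Bpc d h0 R, R1 < ‖x‖ → f x = 0) (i : Fin d) {x : Ed d}
    (hx : x ∈ Bp d h0 R) (hx1 : R1 < ‖x‖) : pder f i x = 0 := by
  have hU : IsOpen (Bp d h0 R ∩ {x | R1 < ‖x‖}) :=
    (Bp_open h0 R).inter (isOpen_lt continuous_const continuous_norm)
  rw [pder_congr (g := fun _ => 0) hU (fun z hz' => hz z (Bp_sub h0 R hz'.1) hz'.2) i ⟨hx, hx1⟩]
  simp [pder]

lemma integrable_van {d : ℕ} {h0 : 0 < d} {R R1 : ℝ} (hR1 : R1 < R) {f : Ed d → ℝ}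
    (hf : ContinuousOn f (Bpc d h0 R)) (hz : ∀ x ∈ Bp d h0 R, R1 < ‖x‖ → f x = 0) :
    IntegrableOn f (Bp d h0 R) := by
  have hcl : IsClosed {x : Ed d | 0 ≤ x (lastIdx d h0)} :=
    isClosed_le continuous_const (cont_coord _)
  have hK : IsCompact (closedBall (0 : Ed d) R1 ∩ {x | 0 ≤ x (lastIdx d h0)}) :=
    (isCompact_closedBall _ _).inter_right hcl
  have h1 : IntegrableOn f (closedBall (0 : Ed d) R1 ∩ {x | 0 ≤ x (lastIdx d h0)}) :=
    (hf.mono (inter_subset_inter_left _ (closedBall_subset_ball hR1))).integrableOn_compact hK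
  refine IntegrableOn.of_forall_sdiff_eq_zero h1 (Bp_open h0 R).measurableSet ?_
  intro x hx
  refine hz x hx.1 ?_
  by_contra hcon
  exact hx.2 ⟨by simpa using hcon, (Bp_sub h0 R hx.1).2⟩

lemma half_div_sum {d : ℕ} (h0 : 0 < d) {R R1 : ℝ} (hR : 0 < R) (hR1 : R1 < R)
    {F : Fin d → Ed d → ℝ}
    (hf : ∀ i, ContDiffOn ℝ (⊤ : ℕ∞) (F i) (Bpc d h0 R))
    (hb : ∀ i, ∀ x ∈ ball (0 : Ed d) R, x (lastIdx d h0) = 0 → F i x = 0)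
    (hz : ∀ i, ∀ x ∈ Bpc d h0 R, R1 < ‖x‖ → F i x = 0) :
    ∫ x in Bp d h0 R, ∑ i, pder (F i) i x = 0 := by
  rw [integral_finsetSum]
  · exact Finset.sum_eq_zero fun i _ =>
      half_div h0 hR hR1 ((hf i).of_le (by exact_mod_cast le_top)) (hb i) (hz i) i
  · intro i _
    obtain ⟨p, hp, hpe⟩ := exists_pder_ext h0 hR (hf i) i
    have := integrable_van hR1 hp.continuousOn (fun x hx hx1 => by
      rw [hpe x hx]; exact pder_vanish (hz i) i hx hx1)
    exact this.congr_fun (fun x hx => hpe x hx) (Bp_open h0 R).measurableSet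

lemma ibp {d : ℕ} (h0 : 0 < d) {R R1 : ℝ} (hR : 0 < R) (hR1 : R1 < R) {v η : Ed d → ℝ}
    (hv : ContDiffOn ℝ (⊤ : ℕ∞) v (Bpc d h0 R))
    (hb : ∀ x ∈ ball (0 : Ed d) R, x (lastIdx d h0) = 0 → v x = 0)
    (hη : ContDiff ℝ (⊤ : ℕ∞) η)
    (hz : ∀ x ∈ Bpc d h0 R, R1 < ‖x‖ → η x = 0) (k : Fin d) :
    ∫ x in Bp d h0 R, v x * pder η k x = - ∫ x in Bp d h0 R, pder v k x * η x := by
  have h1 := half_div h0 hR hR1 (f := fun x => v x * η x)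
    ((hv.mul hη.contDiffOn).of_le (by exact_mod_cast le_top))
    (fun x hx hx0 => by simp [hb x hx hx0]) (fun x hx hx0 => by simp [hz x hx hx0]) k
  obtain ⟨p, hp, hpe⟩ := exists_pder_ext h0 hR hv k
  have i1 : IntegrableOn (fun x => v x * pder η k x) (Bp d h0 R) :=
    integrable_van hR1 (hv.continuousOn.mul (pder_contDiff hη k).continuous.continuousOn)
      (fun x hx hx1 => by rw [pder_vanish hz k hx hx1, mul_zero])
  have i2 : IntegrableOn (fun x => pder v k x * η x) (Bp d h0 R) := by
    refine (integrable_van hR1 (f := fun x => p x * η x)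
      (hp.continuousOn.mul hη.continuous.continuousOn) (fun x hx hx1 => by
        rw [hz x (Bp_sub h0 R hx) hx1, mul_zero])).congr_fun (fun x hx => ?_)
        (Bp_open h0 R).measurableSet
    simp only [hpe x hx]
  have h2 : ∫ x in Bp d h0 R, pder (fun x => v x * η x) k x
      = ∫ x in Bp d h0 R, (v x * pder η k x + pder v k x * η x) := by
    refine setIntegral_congr_fun (Bp_open h0 R).measurableSet fun x hx => ?_
    rw [pder_mul (diffAt_of hv hx) (hη.differentiable (by simp)).differentiableAt]; ring
  rw [h2, integral_add i1 i2] at h1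
  linarith

lemma pder_sum_mul {d : ℕ} {f : Fin d → Ed d → ℝ} {x : Ed d} (c : Fin d → ℝ)
    (hf : ∀ j, DifferentiableAt ℝ (f j) x) (i : Fin d) :
    pder (fun y => ∑ j, c j * f j y) i x = ∑ j, c j * pder (f j) i x := by
  unfold pder
  rw [fderiv_fun_sum (fun j _ => (hf j).const_mul (c j))]
  simp only [sum_apply]
  refine Finset.sum_congr rfl fun j _ => ?_
  rw [fderiv_const_mul (hf j)]; simp

lemma strong_eq {d : ℕ} (h0 : 0 < d) {R : ℝ} (hR : 0 < R) {v : Ed d → ℝ}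
    {A : Matrix (Fin d) (Fin d) ℝ}
    (hv : ContDiffOn ℝ (⊤ : ℕ∞) v (Bpc d h0 R))
    (hw : ∀ ζ : Ed d → ℝ, IsTest (Bp d h0 R) ζ →
        ∫ x in Bp d h0 R, dotv (A.mulVec (gradv v x)) (gradv ζ x) = 0)
    {x : Ed d} (hx : x ∈ Bp d h0 R) :
    ∑ i, ∑ j, A i j * pder (fun y => pder v j y) i x = 0 := by
  choose p hp hpe using fun j => exists_pder_ext h0 hR hv j
  choose pp hpp hppe using fun i j => exists_pder_ext h0 hR (hp j) i
  have hpp2 : ∀ i j, ∀ z ∈ Bp d h0 R, pp i j z = pder (fun y => pder v j y) i z := fun i j z hz => by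
    rw [hppe i j z hz]; exact pder_congr (Bp_open h0 R) (hpe j) i hz
  set E : Ed d → ℝ := fun z => ∑ i, ∑ j, A i j * pp i j z with hE
  have hEc : ContinuousOn E (Bp d h0 R) := by
    refine ContinuousOn.mono ?_ (Bp_sub h0 R)
    exact continuousOn_finsetSum _ fun i _ => continuousOn_finsetSum _ fun j _ =>
      continuousOn_const.mul (hpp i j).continuousOn
  have hint : ∀ g : Ed d → ℝ, ContDiff ℝ (⊤ : ℕ∞) g → HasCompactSupport g →
      tsupport g ⊆ Bp d h0 R → ∫ x, g x • E x = 0 := by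
    intro g hg hgc hgs
    obtain ⟨R1, hR1, hsub⟩ : ∃ R1 < R, tsupport g ⊆ closedBall 0 R1 := by
      obtain ⟨R1, hR1, h⟩ := exists_lt_subset_ball (isClosed_tsupport g)
        (hgs.trans inter_subset_left)
      exact ⟨R1, hR1, h.trans ball_subset_closedBall⟩
    have gout : ∀ z, z ∉ Bp d h0 R → g z = 0 := fun z hz =>
      image_eq_zero_of_notMem_tsupport fun h => hz (hgs h)
    have gout2 : ∀ z, R1 < ‖z‖ → g z = 0 := fun z hz =>
      image_eq_zero_of_notMem_tsupport fun h => by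
        have := hsub h
        simp at this; linarith
    have hdiv := half_div_sum h0 hR hR1 (F := fun i z => g z * ∑ j, A i j * p j z)
      (fun i => hg.contDiffOn.mul (ContDiffOn.sum fun j _ => contDiffOn_const.mul (hp j)))
      (fun i z hz hz0 => by
        rw [gout z (fun h => (ne_of_gt (show 0 < z (lastIdx d h0) from h.2)) hz0), zero_mul])
      (fun i z _ hz1 => by rw [gout2 z hz1, zero_mul])
    have h1 : ∫ z in Bp d h0 R, ∑ i, pder (fun z => g z * ∑ j, A i j * p j z) i z
        = ∫ z in Bp d h0 R, (dotv (A.mulVec (gradv v z)) (gradv g z) + g z * E z) := by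
      refine setIntegral_congr_fun (Bp_open h0 R).measurableSet fun z hz => ?_
      simp only [hE, dotv, Finset.mul_sum]
      rw [← Finset.sum_add_distrib]
      refine Finset.sum_congr rfl fun i _ => ?_
      have hpd : ∀ j, DifferentiableAt ℝ (p j) z := fun j => diffAt_of (hp j) hz
      rw [← Finset.mul_sum]
      rw [show (fun z => ∑ j, g z * (A i j * p j z)) = fun z => g z * ∑ j, A i j * p j z by
        funext z; rw [Finset.mul_sum]]
      rw [pder_mul (hg.differentiable (by simp)).differentiableAt
        (DifferentiableAt.fun_sum fun j _ => (hpd j).const_mul _), pder_sum_mul _ hpd]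
      simp only [Matrix.mulVec, dotProduct, gradv]
      simp only [hppe _ _ z hz, hpe _ z hz]
      ring
    rw [h1, integral_add, hw g ⟨hg, hgc, hgs⟩, zero_add] at hdiv
    · rw [← setIntegral_eq_integral_of_forall_compl_eq_zero (s := Bp d h0 R)]
      · simpa using hdiv
      · intro z hz; simp [gout z hz]
    · refine (integrable_van hR1 (f := fun z => dotv (A.mulVec (fun j => p j z)) (gradv g z))
        ?_ ?_).congr_fun (fun z hz => ?_) (Bp_open h0 R).measurableSet
      · unfold dotv Matrix.mulVec dotProduct gradv
        exact continuousOn_finsetSum _ fun i _ => (continuousOn_finsetSum _ fun j _ =>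
          continuousOn_const.mul (hp j).continuousOn).mul
            (pder_contDiff hg i).continuous.continuousOn
      · intro z hz hz1
        have : ∀ i, gradv g z i = 0 := fun i =>
          pder_vanish (fun x _ hx => gout2 x hx) i hz hz1
        simp [dotv, this]
      · simp only
        congr 2
        funext j; exact hpe j z hz
    · refine integrable_van hR1 (f := fun z => g z * E z) ?_ (fun z _ hz1 => by
        rw [gout2 z hz1, zero_mul])
      exact hg.continuous.continuousOn.mul (continuousOn_finsetSum _ fun i _ =>
        continuousOn_finsetSum _ fun j _ => continuousOn_const.mul (hpp i j).continuousOn)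
  have hae := (Bp_open h0 R).ae_eq_zero_of_integral_contDiff_smul_eq_zero (μ := volume)
    (hEc.locallyIntegrableOn (Bp_open h0 R).measurableSet) hint
  have hEq : EqOn E (fun _ => 0) (Bp d h0 R) := by
    refine Measure.eqOn_open_of_ae_eq (μ := volume) ?_ (Bp_open h0 R) hEc continuousOn_const
    rw [Filter.EventuallyEq, ae_restrict_iff' (Bp_open h0 R).measurableSet]
    exact hae
  have := hEq hx
  simp only [hE] at this
  rw [← this]
  exact Finset.sum_congr rfl fun i _ => Finset.sum_congr rfl fun j _ => by rw [hpp2 i j x hx]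

lemma pder_symm {d : ℕ} {f : Ed d → ℝ} {x : Ed d} (hf : ContDiffAt ℝ 2 f x) (i j : Fin d) :
    pder (fun y => pder f j y) i x = pder (fun y => pder f i y) j x := by
  have hs : IsSymmSndFDerivAt ℝ f x := hf.isSymmSndFDerivAt (by simp)
  have hd : DifferentiableAt ℝ (fderiv ℝ f) x :=
    (hf.fderiv_right (m := 1) (by norm_num)).differentiableAt (by simp)
  have key : ∀ i j : Fin d, pder (fun y => pder f j y) i x
      = fderiv ℝ (fderiv ℝ f) x (EuclideanSpace.single i 1) (EuclideanSpace.single j 1) := by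
    intro i j
    unfold pder
    rw [fderiv_clm_apply hd (differentiableAt_const _)]
    simp
  rw [key, key]; exact hs _ _

lemma contDiffAt_of {d : ℕ} {h0 : 0 < d} {R : ℝ} {f : Ed d → ℝ}
    (hf : ContDiffOn ℝ (⊤ : ℕ∞) f (Bpc d h0 R)) {x : Ed d} (hx : x ∈ Bp d h0 R) :
    ContDiffAt ℝ (⊤ : ℕ∞) f x :=
  hf.contDiffAt (mem_of_superset ((Bp_open h0 R).mem_nhds hx) (Bp_sub h0 R))

lemma strong_eq_S {d : ℕ} (h0 : 0 < d) {R : ℝ} (hR : 0 < R) {v : Ed d → ℝ}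
    {A S : Matrix (Fin d) (Fin d) ℝ} (hS : ∀ i j, S i j = (A i j + A j i)/2)
    (hv : ContDiffOn ℝ (⊤ : ℕ∞) v (Bpc d h0 R))
    (hw : ∀ ζ : Ed d → ℝ, IsTest (Bp d h0 R) ζ →
        ∫ x in Bp d h0 R, dotv (A.mulVec (gradv v x)) (gradv ζ x) = 0)
    {x : Ed d} (hx : x ∈ Bp d h0 R) :
    ∑ i, ∑ j, S i j * pder (fun y => pder v j y) i x = 0 := by
  have h1 := strong_eq h0 hR hv hw hx
  have h2 : ∑ i, ∑ j, A j i * pder (fun y => pder v j y) i x = 0 := by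
    rw [← h1, Finset.sum_comm]
    refine Finset.sum_congr rfl fun i _ => Finset.sum_congr rfl fun j _ => ?_
    rw [pder_symm ((contDiffAt_of hv hx).of_le two_le_inf)]
  have h3 : ∑ i, ∑ j, S i j * pder (fun y => pder v j y) i x
    = (∑ i, ∑ j, A i j * pder (fun y => pder v j y) i x
      + ∑ i, ∑ j, A j i * pder (fun y => pder v j y) i x)/2 := by
    rw [← Finset.sum_add_distrib, Finset.sum_div]
    refine Finset.sum_congr rfl fun i _ => ?_
    rw [← Finset.sum_add_distrib, Finset.sum_div]
    refine Finset.sum_congr rfl fun j _ => ?_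
    rw [hS]; ring
  rw [h3, h1, h2]; simp

lemma green {d : ℕ} (h0 : 0 < d) {R R1 : ℝ} (hR : 0 < R) (hR1 : R1 < R) {v ξ : Ed d → ℝ}
    {S : Matrix (Fin d) (Fin d) ℝ} (hS : ∀ i j, S i j = S j i)
    (hv : ContDiffOn ℝ (⊤ : ℕ∞) v (Bpc d h0 R))
    (hb : ∀ x ∈ ball (0 : Ed d) R, x (lastIdx d h0) = 0 → v x = 0)
    (heq : ∀ x ∈ Bp d h0 R, ∑ i, ∑ j, S i j * pder (fun y => pder v j y) i x = 0)
    (hξ : ContDiff ℝ (⊤ : ℕ∞) ξ)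
    (hξb : ∀ x ∈ ball (0 : Ed d) R, x (lastIdx d h0) = 0 → ξ x = 0)
    (hz : ∀ x ∈ Bpc d h0 R, R1 < ‖x‖ → ξ x = 0) :
    ∫ x in Bp d h0 R, v x * ∑ i, ∑ j, S i j * pder (fun y => pder ξ j y) i x = 0 := by
  choose p hp hpe using fun j => exists_pder_ext h0 hR hv j
  have hdξ := fun j => pder_contDiff hξ j
  have hflat : ∀ x ∈ Bpc d h0 R, x ∉ Bp d h0 R → x (lastIdx d h0) = 0 := by
    intro x hx hxn
    by_contra hc
    exact hxn ⟨hx.1, lt_of_le_of_ne (show 0 ≤ x (lastIdx d h0) from hx.2) (Ne.symm hc)⟩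
  have hdiv := half_div_sum h0 hR hR1
      (F := fun i z => ∑ j, S i j * (v z * pder ξ j z - ξ z * p j z))
      (fun i => ContDiffOn.sum fun j _ => contDiffOn_const.mul
        ((hv.mul (hdξ j).contDiffOn).sub (hξ.contDiffOn.mul (hp j))))
      (fun i z hz hz0 => by simp [hb z hz hz0, hξb z hz hz0])
      (fun i z hz' hz1 => by
        refine Finset.sum_eq_zero fun j _ => ?_
        by_cases hB : z ∈ Bp d h0 R
        · rw [pder_vanish hz j hB hz1, hz z hz' hz1]; simp
        · rw [hb z hz'.1 (hflat z hz' hB), hz z hz' hz1]; simp)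
  rw [← hdiv]
  refine setIntegral_congr_fun (Bp_open h0 R).measurableSet fun z hz => ?_
  have hpd : ∀ j, DifferentiableAt ℝ (p j) z := fun j => diffAt_of (hp j) hz
  have hvd := diffAt_of hv hz
  have hξd : DifferentiableAt ℝ ξ z := (hξ.differentiable (by simp)).differentiableAt
  have hξd2 : ∀ j, DifferentiableAt ℝ (fun y => pder ξ j y) z :=
    fun j => ((hdξ j).differentiable (by simp)).differentiableAt
  have e1 : ∀ i, pder (fun z => ∑ j, S i j * (v z * pder ξ j z - ξ z * p j z)) i z
      = ∑ j, S i j * (pder v i z * pder ξ j z + v z * pder (fun y => pder ξ j y) i z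
        - pder ξ i z * pder v j z - ξ z * pder (fun y => pder v j y) i z) := by
    intro i
    rw [pder_sum_mul (f := fun j z => v z * pder ξ j z - ξ z * p j z) _
      (fun j => (hvd.mul (hξd2 j)).sub (hξd.mul (hpd j)))]
    refine Finset.sum_congr rfl fun j _ => ?_
    congr 1
    have : pder (fun z => v z * pder ξ j z - ξ z * p j z) i z
      = pder (fun z => v z * pder ξ j z) i z - pder (fun z => ξ z * p j z) i z := by
      exact pder_sub (hvd.mul (hξd2 j)) (hξd.mul (hpd j)) i
    rw [this, pder_mul hvd (hξd2 j), pder_mul hξd (hpd j), hpe j z hz,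
      pder_congr (Bp_open h0 R) (hpe j) i hz]
    ring
  simp only [e1]
  have e2 : ∑ i, ∑ j, S i j * (pder v i z * pder ξ j z)
      = ∑ i, ∑ j, S i j * (pder ξ i z * pder v j z) := by
    rw [Finset.sum_comm]
    refine Finset.sum_congr rfl fun i _ => Finset.sum_congr rfl fun j _ => ?_
    rw [hS j i]; ring
  have e3 := heq z hz
  simp only [mul_sub, mul_add, Finset.sum_sub_distrib, Finset.sum_add_distrib]
  rw [e2]
  have e4 : ∑ i, ∑ j, S i j * (ξ z * pder (fun y => pder v j y) i z) = 0 := by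
    rw [← mul_zero (ξ z), ← e3, Finset.mul_sum]
    refine Finset.sum_congr rfl fun i _ => ?_
    rw [Finset.mul_sum]
    exact Finset.sum_congr rfl fun j _ => by ring
  rw [e4, Finset.mul_sum]
  have e5 : ∀ i, v z * ∑ j, S i j * pder (fun y => pder ξ j y) i z
     = ∑ j, S i j * (v z * pder (fun y => pder ξ j y) i z) := fun i => by
    rw [Finset.mul_sum]; exact Finset.sum_congr rfl fun j _ => by ring
  simp only [e5]; ring

def f0 (s : ℝ) : ℝ := Real.smoothTransition (2 - 2 * s)

def F0 (s : ℝ) : ℝ := -(1/2) * ∫ r in (1:ℝ)..s, f0 r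

def k0 (d : ℕ) (s : ℝ) : ℝ := d * f0 s + 2 * s * deriv f0 s

lemma f0_contDiff : ContDiff ℝ (⊤ : ℕ∞) f0 :=
  Real.smoothTransition.contDiff.comp (contDiff_const.sub (contDiff_const.mul contDiff_id))

lemma f0_nonneg (s : ℝ) : 0 ≤ f0 s := Real.smoothTransition.nonneg _
lemma f0_le_one (s : ℝ) : f0 s ≤ 1 := Real.smoothTransition.le_one _
lemma f0_one {s : ℝ} (hs : s ≤ 1/2) : f0 s = 1 :=
  Real.smoothTransition.one_of_one_le (by linarith)
lemma f0_zero {s : ℝ} (hs : 1 ≤ s) : f0 s = 0 :=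
  Real.smoothTransition.zero_of_nonpos (by linarith)

lemma f0_diff : Differentiable ℝ f0 := f0_contDiff.differentiable (by simp)

lemma df0_zero {s : ℝ} (hs : 1 ≤ s) : deriv f0 s = 0 := by
  have : IsLocalMin f0 s := Eventually.of_forall fun r => by rw [f0_zero hs]; exact f0_nonneg r
  exact this.deriv_eq_zero

lemma df0_zero' {s : ℝ} (hs : s ≤ 1/2) : deriv f0 s = 0 := by
  have : IsLocalMax f0 s := Eventually.of_forall fun r => by rw [f0_one hs]; exact f0_le_one r
  exact this.deriv_eq_zero

lemma df0_cont : Continuous (deriv f0) := f0_contDiff.continuous_deriv (by simp)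

lemma df0_bound : ∃ C : ℝ, 0 < C ∧ ∀ s, |deriv f0 s| ≤ C := by
  obtain ⟨C, hC⟩ := (isCompact_Icc (a := (1/2:ℝ)) (b := 1)).exists_bound_of_continuousOn
    df0_cont.continuousOn
  refine ⟨max C 1, by positivity, fun s => ?_⟩
  rcases le_total s (1/2) with h | h
  · rw [df0_zero' h]; simp
  · rcases le_total 1 s with h' | h'
    · rw [df0_zero h']; simp
    · exact (hC s ⟨h, h'⟩).trans (le_max_left _ _)

lemma k0_bound (d : ℕ) : ∃ C : ℝ, 0 < C ∧ ∀ s, |k0 d s| ≤ C := by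
  obtain ⟨C, hC0, hC⟩ := df0_bound
  refine ⟨d + 2 * C, by positivity, fun s => ?_⟩
  have h1 : |s * deriv f0 s| ≤ C := by
    rcases le_total s (1/2) with h | h
    · rw [df0_zero' h]; simp; exact hC0.le
    · rcases le_total 1 s with h' | h'
      · rw [df0_zero h']; simp; exact hC0.le
      · rw [abs_mul, abs_of_nonneg (by linarith : 0 ≤ s)]
        nlinarith [hC s, abs_nonneg (deriv f0 s)]
  unfold k0
  have h2 : |(d:ℝ) * f0 s| ≤ d := by
    rw [abs_of_nonneg (mul_nonneg (by positivity) (f0_nonneg s))]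
    nlinarith [f0_le_one s, (Nat.cast_nonneg d : (0:ℝ) ≤ d)]
  calc |(d:ℝ) * f0 s + 2 * s * deriv f0 s| ≤ |(d:ℝ) * f0 s| + |2 * s * deriv f0 s| := abs_add_le _ _
    _ = |(d:ℝ) * f0 s| + 2 * |s * deriv f0 s| := by
        rw [mul_assoc, abs_mul 2]; simp
    _ ≤ _ := by linarith

lemma k0_zero (d : ℕ) {s : ℝ} (hs : 1 ≤ s) : k0 d s = 0 := by
  simp [k0, f0_zero hs, df0_zero hs]

lemma k0_cont (d : ℕ) : Continuous (k0 d) := by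
  have := f0_contDiff.continuous
  have := df0_cont
  unfold k0; fun_prop

lemma F0_hasDeriv (s : ℝ) : HasDerivAt F0 (-(1/2) * f0 s) s := by
  unfold F0
  exact (intervalIntegral.integral_hasDerivAt_right (f0_contDiff.continuous.intervalIntegrable _ _)
    (f0_contDiff.continuous.stronglyMeasurableAtFilter _ _)
    f0_contDiff.continuous.continuousAt).const_mul _

lemma F0_contDiff : ContDiff ℝ (⊤ : ℕ∞) F0 := by
  rw [contDiff_infty_iff_deriv]
  refine ⟨fun s => (F0_hasDeriv s).differentiableAt, ?_⟩
  have : deriv F0 = fun s => -(1/2) * f0 s := funext fun s => (F0_hasDeriv s).deriv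
  rw [this]
  exact contDiff_const.mul f0_contDiff

lemma F0_zero {s : ℝ} (hs : 1 ≤ s) : F0 s = 0 := by
  unfold F0
  have : ∫ r in (1:ℝ)..s, f0 r = ∫ r in (1:ℝ)..s, (0:ℝ) := by
    refine intervalIntegral.integral_congr fun r hr => ?_
    rw [uIcc_of_le hs] at hr
    exact f0_zero hr.1
  rw [this]; simp

/-- linear functional `x ↦ (M x)_j` -/
def mv {d : ℕ} (M : Matrix (Fin d) (Fin d) ℝ) (j : Fin d) (x : Ed d) : ℝ := M.mulVec x.ofLp j

lemma mv_contDiff {d : ℕ} (M : Matrix (Fin d) (Fin d) ℝ) (j : Fin d) :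
    ContDiff ℝ (⊤ : ℕ∞) (mv M j) := by
  unfold mv Matrix.mulVec dotProduct
  fun_prop

lemma qf_contDiff {d : ℕ} (M : Matrix (Fin d) (Fin d) ℝ) : ContDiff ℝ (⊤ : ℕ∞) (qf M) := by
  unfold qf dotv Matrix.mulVec dotProduct
  fun_prop

lemma mv_add {d : ℕ} (M : Matrix (Fin d) (Fin d) ℝ) (j : Fin d) (x y : Ed d) :
    mv M j (x + y) = mv M j x + mv M j y := by
  simp [mv, Matrix.mulVec_add]

lemma mv_smul {d : ℕ} (M : Matrix (Fin d) (Fin d) ℝ) (j : Fin d) (c : ℝ) (x : Ed d) :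
    mv M j (c • x) = c * mv M j x := by
  simp [mv, Matrix.mulVec_smul]

lemma mv_single {d : ℕ} (M : Matrix (Fin d) (Fin d) ℝ) (j i : Fin d) :
    mv M j (EuclideanSpace.single i 1) = M j i := by
  simp [mv]

lemma qf_eq {d : ℕ} (M : Matrix (Fin d) (Fin d) ℝ) (x : Ed d) : qf M x = ∑ j, x j * mv M j x := rfl

lemma qf_add {d : ℕ} {M : Matrix (Fin d) (Fin d) ℝ} (hM : ∀ i j, M i j = M j i) (x y : Ed d) :
    qf M (x + y) = qf M x + 2 * (∑ j, y j * mv M j x) + qf M y := by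
  have h1 : ∑ j, x j * mv M j y = ∑ j, y j * mv M j x := by
    simp only [mv, Matrix.mulVec, dotProduct, Finset.mul_sum]
    rw [Finset.sum_comm]
    refine Finset.sum_congr rfl fun i _ => Finset.sum_congr rfl fun j _ => ?_
    rw [hM i j]; ring
  simp only [qf_eq, mv_add, PiLp.add_apply, add_mul, mul_add, Finset.sum_add_distrib]
  rw [h1]; ring

lemma qf_smul {d : ℕ} (M : Matrix (Fin d) (Fin d) ℝ) (c : ℝ) (x : Ed d) :
    qf M (c • x) = c^2 * qf M x := by
  simp only [qf_eq, mv_smul, PiLp.smul_apply, smul_eq_mul, Finset.mul_sum]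
  exact Finset.sum_congr rfl fun j _ => by ring

/-- derivative along a line -/
lemma pder_of_line {d : ℕ} {f : Ed d → ℝ} {x : Ed d} {i : Fin d} {a : ℝ}
    (hf : DifferentiableAt ℝ f x)
    (h : HasDerivAt (fun s : ℝ => f (x + s • EuclideanSpace.single i (1:ℝ))) a 0) :
    pder f i x = a := by
  unfold pder
  rw [← hf.lineDeriv_eq_fderiv]
  exact HasLineDerivAt.lineDeriv h

lemma pder_qf {d : ℕ} {M : Matrix (Fin d) (Fin d) ℝ} (hM : ∀ i j, M i j = M j i)
    (i : Fin d) (y x : Ed d) : pder (fun z => qf M (y - z)) i x = -2 * mv M i (y - x) := by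
  have hd : ContDiff ℝ (⊤ : ℕ∞) (fun z => qf M (y - z)) :=
    (qf_contDiff M).comp (contDiff_const.sub contDiff_id)
  apply pder_of_line (hd.differentiable (by simp)).differentiableAt
  have : (fun s : ℝ => qf M (y - (x + s • EuclideanSpace.single i (1:ℝ))))
      = fun s => qf M (y - x) - 2 * s * mv M i (y - x) + s^2 * qf M (EuclideanSpace.single i (1:ℝ)) := by
    funext s
    rw [show y - (x + s • EuclideanSpace.single i (1:ℝ)) = (y - x) + (-s) • EuclideanSpace.single i (1:ℝ)
      by module, qf_add hM, qf_smul]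
    simp; ring
  rw [this]
  have h1 := (((hasDerivAt_id (0:ℝ)).const_mul 2).mul_const (mv M i (y - x)))
  have h2 := ((hasDerivAt_id (0:ℝ)).pow 2).mul_const (qf M (EuclideanSpace.single i (1:ℝ)))
  have h3 := ((hasDerivAt_const (0:ℝ) (qf M (y - x))).sub h1).add h2
  refine h3.congr_deriv ?_
  simp

lemma pder_mv {d : ℕ} (M : Matrix (Fin d) (Fin d) ℝ)
    (i j : Fin d) (y x : Ed d) : pder (fun z => mv M j (y - z)) i x = - M j i := by
  have hd : ContDiff ℝ (⊤ : ℕ∞) (fun z => mv M j (y - z)) :=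
    (mv_contDiff M j).comp (contDiff_const.sub contDiff_id)
  apply pder_of_line (hd.differentiable (by simp)).differentiableAt
  have : (fun s : ℝ => mv M j (y - (x + s • EuclideanSpace.single i (1:ℝ))))
      = fun s => mv M j (y - x) - s * M j i := by
    funext s
    rw [show y - (x + s • EuclideanSpace.single i (1:ℝ)) = (y - x) + (-s) • EuclideanSpace.single i (1:ℝ)
      by module, mv_add, mv_smul, mv_single]
    ring
  rw [this]
  have h1 := ((hasDerivAt_id (0:ℝ)).mul_const (M j i))
  refine ((hasDerivAt_const (0:ℝ) (mv M j (y - x))).sub h1).congr_deriv ?_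
  simp

lemma pder_comp1 {d : ℕ} {g : ℝ → ℝ} {f : Ed d → ℝ} {x : Ed d} {g' : ℝ}
    (hg : HasDerivAt g g' (f x)) (hf : DifferentiableAt ℝ f x) (i : Fin d) :
    pder (fun z => g (f z)) i x = g' * pder f i x := by
  unfold pder
  have := (hg.comp_hasFDerivAt x hf.hasFDerivAt).fderiv
  rw [show (fun z => g (f z)) = g ∘ f from rfl, this]; simp

lemma Q_contDiff {d : ℕ} (M : Matrix (Fin d) (Fin d) ℝ) (t : ℝ) (y : Ed d) :
    ContDiff ℝ (⊤ : ℕ∞) (fun z => qf M (y - z) / t^2) :=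
  ((qf_contDiff M).comp (contDiff_const.sub contDiff_id)).div_const _

lemma pder_Q {d : ℕ} {M : Matrix (Fin d) (Fin d) ℝ} (hM : ∀ i j, M i j = M j i)
    (i : Fin d) (t : ℝ) (y x : Ed d) :
    pder (fun z => qf M (y - z) / t^2) i x = -2 * mv M i (y - x) / t^2 := by
  have h1 := pder_comp1 (g := fun s => s / t^2) (f := fun z => qf M (y - z)) (x := x)
    ((hasDerivAt_id _).div_const (t^2))
    (((qf_contDiff M).comp (contDiff_const.sub contDiff_id)).differentiable (by simp)).differentiableAt i
  rw [h1, pder_qf hM]; ring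

lemma ker_lap {d : ℕ} {h0 : 0 < d} {lam : ℝ} {S M : Matrix (Fin d) (Fin d) ℝ}
    (hF : MF h0 lam S M) {t : ℝ} (ht : 0 < t) (y x : Ed d) :
    ∑ i, ∑ j, S i j * pder (fun w => pder (fun z => F0 (qf M (y - z) / t^2)) j w) i x
      = - (k0 d (qf M (y - x) / t^2)) / t^2 := by
  have e1 : ∀ j, (fun w => pder (fun z => F0 (qf M (y - z) / t^2)) j w)
      = fun w => f0 (qf M (y - w) / t^2) * (mv M j (y - w) * (1/ t^2)) := by
    intro j; funext w
    rw [pder_comp1 (F0_hasDeriv _) ((Q_contDiff M t y).differentiable (by simp)).differentiableAt,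
      pder_Q hF.Ms]
    ring
  have hmd : ∀ j, DifferentiableAt ℝ (fun w => mv M j (y - w)) x := fun j =>
    (((mv_contDiff M j).comp (contDiff_const.sub contDiff_id)).differentiable (by simp)).differentiableAt
  have hQd : DifferentiableAt ℝ (fun z => qf M (y - z) / t^2) x :=
    ((Q_contDiff M t y).differentiable (by simp)).differentiableAt
  set Q := qf M (y - x) / t^2 with hQ
  have e2 : ∀ i j, pder (fun w => pder (fun z => F0 (qf M (y - z) / t^2)) j w) i x
      = deriv f0 Q * (-2 / t^4) * (mv M i (y - x) * mv M j (y - x)) - f0 Q / t^2 * M j i := by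
    intro i j
    rw [e1, pder_mul (f := fun w => f0 (qf M (y - w) / t^2)) (g := fun w => mv M j (y - w) * (1 / t^2))
      (f0_diff.differentiableAt.comp x hQd) ((hmd j).mul_const _),
      pder_comp1 (f0_diff.differentiableAt.hasDerivAt) hQd, pder_Q hF.Ms,
      pder_comp1 (g := fun s => s * (1/t^2)) ((hasDerivAt_id _).mul_const _) (hmd j), pder_mv]
    rw [← hQ]
    field_simp
    ring
  simp only [e2, mul_sub, Finset.sum_sub_distrib]
  have e3 : ∑ i, ∑ j, S i j * (deriv f0 Q * (-2 / t^4) * (mv M i (y - x) * mv M j (y - x)))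
      = deriv f0 Q * (-2 / t^4) * qf M (y - x) := by
    rw [qf_eq, Finset.mul_sum]
    refine Finset.sum_congr rfl fun i _ => ?_
    have : (y - x) i = ∑ j, S i j * mv M j (y - x) := by
      have h : S.mulVec (M.mulVec (y - x).ofLp) = (y - x).ofLp := by
        rw [Matrix.mulVec_mulVec, hF.SM, Matrix.one_mulVec]
      conv_lhs => rw [← h]
      rfl
    rw [this, Finset.sum_mul, Finset.mul_sum]
    exact Finset.sum_congr rfl fun j _ => by ring
  have e4 : ∑ i, ∑ j, S i j * (f0 Q / t^2 * M j i) = f0 Q / t^2 * d := by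
    have h : ∀ i, ∑ j, S i j * M j i = 1 := fun i => by
      rw [← Matrix.mul_apply, hF.SM]; simp
    calc ∑ i, ∑ j, S i j * (f0 Q / t^2 * M j i) = ∑ i, f0 Q / t^2 * ∑ j, S i j * M j i := by
          refine Finset.sum_congr rfl fun i _ => ?_
          rw [Finset.mul_sum]
          exact Finset.sum_congr rfl fun j _ => by ring
      _ = _ := by simp [h]; ring
  rw [e3, e4, k0]
  have : qf M (y - x) = Q * t^2 := by rw [hQ]; field_simp
  rw [this]; field_simp; ring

/-- the normal vector `S e_d` -/
def nv {d : ℕ} (h0 : 0 < d) (S : Matrix (Fin d) (Fin d) ℝ) : Ed d :=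
  WithLp.toLp 2 (fun i => S i (lastIdx d h0))

/-- the oblique reflection -/
def Pr {d : ℕ} (h0 : 0 < d) (S : Matrix (Fin d) (Fin d) ℝ) (y : Ed d) : Ed d :=
  y - (2 * y (lastIdx d h0) / S (lastIdx d h0) (lastIdx d h0)) • nv h0 S

lemma MS_one {d : ℕ} {h0 : 0 < d} {lam : ℝ} {S M : Matrix (Fin d) (Fin d) ℝ}
    (hF : MF h0 lam S M) : M * S = 1 := mul_eq_one_comm.1 hF.SM

lemma Pr_last {d : ℕ} {h0 : 0 < d} {lam : ℝ} (hlam : 0 < lam) {S M : Matrix (Fin d) (Fin d) ℝ}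
    (hF : MF h0 lam S M) (y : Ed d) : Pr h0 S y (lastIdx d h0) = - y (lastIdx d h0) := by
  have := hF.Sd
  have h : S (lastIdx d h0) (lastIdx d h0) ≠ 0 := by linarith
  simp only [Pr, nv, PiLp.sub_apply, PiLp.smul_apply, smul_eq_mul]
  field_simp; ring

lemma qf_Pr {d : ℕ} {h0 : 0 < d} {lam : ℝ} (hlam : 0 < lam) {S M : Matrix (Fin d) (Fin d) ℝ}
    (hF : MF h0 lam S M) (y z : Ed d) :
    qf M (Pr h0 S y - z) = qf M (y - z) + 4 * y (lastIdx d h0) * z (lastIdx d h0)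
      / S (lastIdx d h0) (lastIdx d h0) := by
  have := hF.Sd
  set l := lastIdx d h0 with hl
  have h : S l l ≠ 0 := by linarith
  have hMn : ∀ j, mv M j (nv h0 S) = if j = l then 1 else 0 := by
    intro j
    have : mv M j (nv h0 S) = (M * S) j l := by
      rw [Matrix.mul_apply]; rfl
    rw [this, MS_one hF, Matrix.one_apply]
  have e1 : ∀ w : Ed d, ∑ j, nv h0 S j * mv M j w = w l := by
    intro w
    have h1 := qf_add hF.Ms w (nv h0 S)
    have h2 := qf_add hF.Ms (nv h0 S) w
    rw [add_comm] at h2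
    have h3 : ∑ j, w j * mv M j (nv h0 S) = w l := by simp [hMn]
    rw [h3] at h2
    linarith
  have e2 : qf M (nv h0 S) = S l l := by
    rw [qf_eq, e1]; rfl
  rw [show Pr h0 S y - z = (y - z) + (-(2 * y l / S l l)) • nv h0 S by
    simp only [Pr, ← hl]; module, qf_add hF.Ms, qf_smul, e2]
  have e3 : ∑ j, ((-(2 * y l / S l l)) • nv h0 S) j * mv M j (y - z)
      = -(2 * y l / S l l) * (y l - z l) := by
    have := e1 (y - z)
    simp only [PiLp.sub_apply] at this
    rw [← this, Finset.mul_sum]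
    exact Finset.sum_congr rfl fun j _ => by simp only [PiLp.smul_apply, smul_eq_mul]; ring
  rw [e3]; field_simp; ring

def uu {d : ℕ} (h0 : 0 < d) (R1 : ℝ) (v : Ed d → ℝ) : Ed d → ℝ := (Bp d h0 R1).indicator v

lemma uu_int {d : ℕ} {h0 : 0 < d} {R R1 : ℝ} (hR1 : R1 < R) {v : Ed d → ℝ}
    (hv : ContinuousOn v (Bpc d h0 R)) : Integrable (uu h0 R1 v) := by
  unfold uu
  rw [integrable_indicator_iff (Bp_open h0 R1).measurableSet]
  have hK : IsCompact (closedBall (0 : Ed d) R1 ∩ {x | 0 ≤ x (lastIdx d h0)}) :=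
    (isCompact_closedBall _ _).inter_right (isClosed_le continuous_const (cont_coord _))
  have hs : closedBall (0 : Ed d) R1 ∩ {x | 0 ≤ x (lastIdx d h0)} ⊆ Bpc d h0 R := by
    intro x hx
    exact ⟨closedBall_subset_ball hR1 hx.1, hx.2⟩
  refine ((hv.mono hs).integrableOn_compact hK).mono_set ?_
  intro x hx
  exact ⟨ball_subset_closedBall hx.1, (Bp_sub h0 R1 hx).2⟩

lemma uu_mul {d : ℕ} {h0 : 0 < d} {R R1 : ℝ} (hR1 : R1 < R) {v g : Ed d → ℝ}
    (hg : ∀ z ∈ Bpc d h0 R, R1 ≤ ‖z‖ → g z = 0) :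
    ∫ z, uu h0 R1 v z * g z = ∫ z in Bp d h0 R, v z * g z := by
  rw [← integral_indicator (Bp_open h0 R).measurableSet]
  congr 1
  funext z
  unfold uu
  by_cases hz : z ∈ Bp d h0 R
  · rw [indicator_of_mem hz]
    by_cases hz1 : z ∈ Bp d h0 R1
    · rw [indicator_of_mem hz1]
    · rw [indicator_of_notMem hz1]
      have : R1 ≤ ‖z‖ := by
        by_contra hlt
        push Not at hlt
        exact hz1 ⟨by simpa using hlt, hz.2⟩
      rw [hg z (Bp_sub h0 R hz) this]; simp
  · have hz1 : z ∉ Bp d h0 R1 := fun h => hz ⟨ball_subset_ball hR1.le h.1, h.2⟩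
    rw [indicator_of_notMem hz, indicator_of_notMem hz1]; simp

lemma kern_deriv (d : ℕ) (q : ℝ) {t : ℝ} (ht : 0 < t) :
    HasDerivAt (fun t : ℝ => (t^d)⁻¹ * f0 (q/t^2)) (-((t^(d+1))⁻¹ * k0 d (q/t^2))) t := by
  have h1 : HasDerivAt (fun t : ℝ => (t^d)⁻¹) (-(d * (t^(d+1))⁻¹)) t := by
    have := (hasDerivAt_pow d t).fun_inv (by positivity)
    refine this.congr_deriv ?_
    rcases d with _ | n
    · simp
    · simp; field_simp; ring
  have h2 : HasDerivAt (fun t : ℝ => q/t^2) (-(2 * q / t^3)) t := by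
    have := ((hasDerivAt_pow 2 t).fun_inv (by positivity)).const_mul q
    simp only [← div_eq_mul_inv] at this
    refine this.congr_deriv ?_
    simp; field_simp
  have h3 : HasDerivAt (fun t : ℝ => f0 (q/t^2)) (deriv f0 (q/t^2) * (-(2 * q / t^3))) t :=
    HasDerivAt.comp (h₂ := f0) t (f0_diff _).hasDerivAt h2
  refine (h1.mul h3).congr_deriv ?_
  unfold k0
  field_simp
  ring

lemma qf_cont {d : ℕ} (M : Matrix (Fin d) (Fin d) ℝ) (y : Ed d) (t : ℝ) :
    Continuous (fun z : Ed d => qf M (y - z) / t^2) := (Q_contDiff M t y).continuous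

lemma mt_deriv {d : ℕ} {h0 : 0 < d} {lam : ℝ} (hlam : 0 < lam) {S M : Matrix (Fin d) (Fin d) ℝ}
    (hF : MF h0 lam S M) {R R1 T : ℝ} (hR : 0 < R) (hR1 : R1 < R) {v : Ed d → ℝ}
    (hv : ContDiffOn ℝ (⊤ : ℕ∞) v (Bpc d h0 R))
    (hb : ∀ x ∈ ball (0 : Ed d) R, x (lastIdx d h0) = 0 → v x = 0)
    (heq : ∀ x ∈ Bp d h0 R, ∑ i, ∑ j, S i j * pder (fun y => pder v j y) i x = 0)
    {y : Ed d} (hy : ∀ z ∈ Bpc d h0 R, R1 ≤ ‖z‖ → T^2 ≤ qf M (y - z))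
    (hPy : ∀ z ∈ Bpc d h0 R, R1 ≤ ‖z‖ → T^2 ≤ qf M (Pr h0 S y - z))
    {t : ℝ} (ht : 0 < t) (htT : t < T) :
    HasDerivAt (fun t : ℝ => ∫ z, uu h0 R1 v z *
      ((t^d)⁻¹ * f0 (qf M (y - z)/t^2) - (t^d)⁻¹ * f0 (qf M (Pr h0 S y - z)/t^2))) 0 t := by
  obtain ⟨C, hC, hCb⟩ := k0_bound d
  have hui := uu_int (h0 := h0) hR1 hv.continuousOn
  have one_le : ∀ y' : Ed d, (∀ z ∈ Bpc d h0 R, R1 ≤ ‖z‖ → T^2 ≤ qf M (y' - z)) →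
      ∀ z ∈ Bpc d h0 R, R1 ≤ ‖z‖ → 1 ≤ qf M (y' - z)/t^2 := by
    intro y' h z hz hz1
    rw [le_div_iff₀ (by positivity)]
    have := h z hz hz1
    nlinarith
  have h1y := one_le y hy
  have h1P := one_le _ hPy
  have key := hasDerivAt_integral_of_dominated_loc_of_deriv_le (μ := (volume : Measure (Ed d)))
    (F := fun (t:ℝ) z => uu h0 R1 v z *
      ((t^d)⁻¹ * f0 (qf M (y - z)/t^2) - (t^d)⁻¹ * f0 (qf M (Pr h0 S y - z)/t^2)))
    (F' := fun (t:ℝ) z => uu h0 R1 v z *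
      (-((t^(d+1))⁻¹ * k0 d (qf M (y - z)/t^2)) - -((t^(d+1))⁻¹ * k0 d (qf M (Pr h0 S y - z)/t^2))))
    (x₀ := t) (s := ball t (t/2)) (bound := fun z => |uu h0 R1 v z| * (((t/2)^(d+1))⁻¹ * (2*C)))
    (ball_mem_nhds _ (by positivity)) ?_ ?_ ?_ ?_ ?_ ?_
  · refine key.2.congr_deriv ?_
    rw [uu_mul hR1]
    · have hsm : ∀ y' : Ed d, ContDiff ℝ (⊤ : ℕ∞) (fun z => F0 (qf M (y' - z)/t^2)) := fun y' =>
        F0_contDiff.comp (Q_contDiff M t y')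
      have hg := green h0 hR hR1 (v := v) (ξ := fun z => F0 (qf M (y - z)/t^2) -
        F0 (qf M (Pr h0 S y - z)/t^2)) hF.Ss hv hb heq ((hsm _).sub (hsm _)) ?_ ?_
      · rw [← mul_zero ((t^(d+1))⁻¹ * t^2), ← hg, ← integral_const_mul]
        congr 1
        funext x
        have e : ∀ i j, pder (fun w => pder (fun z => F0 (qf M (y - z)/t^2) -
            F0 (qf M (Pr h0 S y - z)/t^2)) j w) i x =
            pder (fun w => pder (fun z => F0 (qf M (y - z)/t^2)) j w) i x -
            pder (fun w => pder (fun z => F0 (qf M (Pr h0 S y - z)/t^2)) j w) i x := by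
          intro i j
          rw [← pder_sub ((pder_contDiff (hsm _) j).differentiable (by simp) _)
            ((pder_contDiff (hsm _) j).differentiable (by simp) _)]
          congr 1
          funext w
          exact pder_sub ((hsm _).differentiable (by simp) _) ((hsm _).differentiable (by simp) _) j
        simp only [e, mul_sub, Finset.sum_sub_distrib]
        rw [ker_lap hF ht, ker_lap hF ht]
        field_simp
      · intro x _ hx
        rw [qf_Pr hlam hF, hx]; simp
      · intro x hx hx1
        rw [F0_zero (h1y x hx hx1.le), F0_zero (h1P x hx hx1.le)]; simp
    · intro z hz hz1
      rw [k0_zero d (h1y z hz hz1), k0_zero d (h1P z hz hz1)]; simp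
  · refine Eventually.of_forall fun s => hui.aestronglyMeasurable.mul ?_
    refine Continuous.aestronglyMeasurable ?_
    exact (continuous_const.mul (f0_contDiff.continuous.comp (qf_cont M y s))).sub
      (continuous_const.mul (f0_contDiff.continuous.comp (qf_cont M _ s)))
  · refine hui.mul_bdd (c := (t^d)⁻¹ * 1 + (t^d)⁻¹ * 1) ?_ ?_
    · refine Continuous.aestronglyMeasurable ?_
      exact (continuous_const.mul (f0_contDiff.continuous.comp (qf_cont M y t))).sub
        (continuous_const.mul (f0_contDiff.continuous.comp (qf_cont M _ t)))
    · refine Eventually.of_forall fun z => (norm_sub_le _ _).trans ?_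
      rw [norm_mul, norm_mul, Real.norm_of_nonneg (by positivity : 0 ≤ (t^d)⁻¹),
        Real.norm_of_nonneg (f0_nonneg _), Real.norm_of_nonneg (f0_nonneg _)]
      gcongr <;> exact f0_le_one _
  · refine hui.aestronglyMeasurable.mul (Continuous.aestronglyMeasurable ?_)
    exact (continuous_const.mul ((k0_cont d).comp (qf_cont M y t))).neg.sub
      (continuous_const.mul ((k0_cont d).comp (qf_cont M _ t))).neg
  · refine Eventually.of_forall fun z s hs => ?_
    have hs' : t/2 < s := by
      rw [mem_ball, Real.dist_eq, abs_lt] at hs; linarith [hs.1]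
    have hs0 : 0 < s := by linarith
    rw [norm_mul, Real.norm_eq_abs]
    gcongr
    rw [← neg_sub', norm_neg, ← mul_sub, norm_mul, Real.norm_of_nonneg (by positivity)]
    gcongr
    refine (norm_sub_le _ _).trans ?_
    rw [Real.norm_eq_abs, Real.norm_eq_abs]
    linarith [hCb (qf M (y - z)/s^2), hCb (qf M (Pr h0 S y - z)/s^2)]
  · exact hui.abs.mul_const _
  · refine Eventually.of_forall fun z s hs => ?_
    have hs' : t/2 < s := by
      rw [mem_ball, Real.dist_eq, abs_lt] at hs; linarith [hs.1]
    exact ((kern_deriv d _ (by linarith)).sub (kern_deriv d _ (by linarith))).const_mul _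

lemma qf_small {d : ℕ} {h0 : 0 < d} {lam : ℝ} (hlam : 0 < lam) {S M : Matrix (Fin d) (Fin d) ℝ}
    (hF : MF h0 lam S M) {t : ℝ} (ht : 0 < t) {x : Ed d} (h : qf M x / t^2 < 1) :
    ‖x‖ ≤ t * d / Real.sqrt lam := by
  have h1 := hF.qlow x
  have hd : (0:ℝ) < d := by exact_mod_cast h0
  rw [div_lt_one (by positivity)] at h
  rw [le_div_iff₀ (Real.sqrt_pos.2 hlam)]
  refine abs_le_of_sq_le_sq' ?_ (by positivity) |>.2
  rw [mul_pow, mul_pow, Real.sq_sqrt hlam.le]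
  have h2 : lam / d^2 * ‖x‖^2 ≤ t^2 := by linarith
  rw [div_mul_eq_mul_div, div_le_iff₀ (by positivity)] at h2
  linarith

def Ph {d : ℕ} (M : Matrix (Fin d) (Fin d) ℝ) (t : ℝ) (x : Ed d) : ℝ := f0 (qf M x / t^2)

lemma Ph_contDiff {d : ℕ} (M : Matrix (Fin d) (Fin d) ℝ) (t : ℝ) :
    ContDiff ℝ (⊤ : ℕ∞) (Ph M t) := by
  unfold Ph
  exact f0_contDiff.comp ((qf_contDiff M).div_const _)

lemma Ph_comp {d : ℕ} {h0 : 0 < d} {lam : ℝ} (hlam : 0 < lam) {S M : Matrix (Fin d) (Fin d) ℝ}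
    (hF : MF h0 lam S M) {t : ℝ} (ht : 0 < t) : HasCompactSupport (Ph M t) := by
  refine HasCompactSupport.intro (isCompact_closedBall (0 : Ed d) (t * d / Real.sqrt lam)) ?_
  intro x hx
  by_contra hne
  apply hx
  rw [mem_closedBall_zero_iff]
  refine qf_small hlam hF ht ?_
  by_contra hh
  exact hne (f0_zero (not_lt.1 hh))

def c0 {d : ℕ} (M : Matrix (Fin d) (Fin d) ℝ) : ℝ := ∫ x : Ed d, Ph M 1 x

lemma c0_low {d : ℕ} {h0 : 0 < d} {lam : ℝ} (hlam : 0 < lam) {S M : Matrix (Fin d) (Fin d) ℝ}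
    (hF : MF h0 lam S M) :
    volume.real (ball (0 : Ed d) (Real.sqrt (lam/2))) ≤ c0 M := by
  unfold c0
  rw [← integral_indicator_one measurableSet_ball]
  refine integral_mono ?_ ?_ ?_
  · exact (integrable_indicator_iff measurableSet_ball).2 (integrableOn_const measure_ball_lt_top.ne)
  · exact (Ph_contDiff M 1).continuous.integrable_of_hasCompactSupport (Ph_comp hlam hF one_pos)
  · intro x
    by_cases hx : x ∈ ball (0 : Ed d) (Real.sqrt (lam/2))
    · rw [indicator_of_mem hx]
      unfold Ph
      rw [f0_one]
      · simp
      · have h1 := hF.qup x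
        rw [mem_ball_zero_iff] at hx
        have h2 : ‖x‖^2 ≤ lam/2 := by
          rw [← Real.sq_sqrt (by positivity : 0 ≤ lam/2)]
          gcongr
        have h3 : ‖x‖^2/lam ≤ 1/2 := by
          rw [div_le_iff₀ hlam]; linarith
        simp only [one_pow, div_one]
        linarith
    · rw [indicator_of_notMem hx]; exact f0_nonneg _

lemma vball_pos {d : ℕ} {lam : ℝ} (hlam : 0 < lam) :
    0 < volume.real (ball (0 : Ed d) (Real.sqrt (lam/2))) :=
  ENNReal.toReal_pos (measure_ball_pos _ _ (Real.sqrt_pos.2 (by positivity))).ne'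
    measure_ball_lt_top.ne

lemma lim_kern {d : ℕ} {h0 : 0 < d} {lam : ℝ} (hlam : 0 < lam) {S M : Matrix (Fin d) (Fin d) ℝ}
    (hF : MF h0 lam S M) {u : Ed d → ℝ} (hu : Integrable u) {y : Ed d} (hy : ContinuousAt u y) :
    Tendsto (fun c : ℝ => ∫ z, u z * (((c⁻¹)^d)⁻¹ * f0 (qf M (y - z)/(c⁻¹)^2))) atTop
      (𝓝 (c0 M * u y)) := by
  have hc0 : 0 < c0 M := (vball_pos hlam).trans_le (c0_low hlam hF)
  have h := tendsto_integral_comp_smul_smul_of_integrable' (μ := (volume : Measure (Ed d)))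
    (φ := fun x => Ph M 1 x / c0 M) (fun x => div_nonneg (f0_nonneg _) hc0.le)
    (by rw [integral_div]; exact div_self hc0.ne') ?_ hu hy
  · have h2 := h.const_mul (c0 M)
    refine h2.congr' ?_
    filter_upwards [eventually_gt_atTop 0] with c hc
    rw [← integral_const_mul]
    congr 1
    funext z
    simp only [Ph, finrank_euclideanSpace, Fintype.card_fin, smul_eq_mul, qf_smul]
    have : c^2 * qf M (y - z)/1^2 = qf M (y-z)/(c⁻¹)^2 := by field_simp
    rw [this, inv_pow c d, inv_inv]
    field_simp
  · refine tendsto_const_nhds.congr' ?_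
    rw [EventuallyEq, ← comap_norm_atTop]
    filter_upwards [preimage_mem_comap (Ioi_mem_atTop (1 * d / Real.sqrt lam))] with x hx
    have : Ph M 1 x = 0 := by
      refine f0_zero ?_
      by_contra hh
      have := qf_small hlam hF one_pos (not_le.1 hh)
      exact absurd hx (not_lt.2 this)
    rw [this]; simp

lemma kern_int {d : ℕ} {M : Matrix (Fin d) (Fin d) ℝ} {u : Ed d → ℝ} (hu : Integrable u)
    (y : Ed d) {t : ℝ} (ht : 0 < t) :
    Integrable (fun z => u z * ((t^d)⁻¹ * f0 (qf M (y - z)/t^2))) := by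
  refine hu.mul_bdd (c := (t^d)⁻¹ * 1) ?_ ?_
  · exact (continuous_const.mul (f0_contDiff.continuous.comp (qf_cont M y t))).aestronglyMeasurable
  · refine Eventually.of_forall fun z => ?_
    rw [norm_mul, Real.norm_of_nonneg (by positivity : 0 ≤ (t^d)⁻¹),
        Real.norm_of_nonneg (f0_nonneg _)]
    gcongr
    exact f0_le_one _

lemma repr {d : ℕ} {h0 : 0 < d} {lam : ℝ} (hlam : 0 < lam) {S M : Matrix (Fin d) (Fin d) ℝ}
    (hF : MF h0 lam S M) {R R1 T : ℝ} (hR : 0 < R) (hR1 : R1 < R) {v : Ed d → ℝ}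
    (hv : ContDiffOn ℝ (⊤ : ℕ∞) v (Bpc d h0 R))
    (hb : ∀ x ∈ ball (0 : Ed d) R, x (lastIdx d h0) = 0 → v x = 0)
    (heq : ∀ x ∈ Bp d h0 R, ∑ i, ∑ j, S i j * pder (fun y => pder v j y) i x = 0)
    {y : Ed d} (hyB : y ∈ Bp d h0 R1) (hy : ∀ z ∈ Bpc d h0 R, R1 ≤ ‖z‖ → T^2 ≤ qf M (y - z))
    {t : ℝ} (ht : 0 < t) (htT : t < T) :
    c0 M * v y = (t^d)⁻¹ * ((∫ z, uu h0 R1 v z * Ph M t (y - z)) -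
      ∫ z, uu h0 R1 v z * Ph M t (Pr h0 S y - z)) := by
  have hl : 0 < y (lastIdx d h0) := hyB.2
  have hPy : ∀ z ∈ Bpc d h0 R, R1 ≤ ‖z‖ → T^2 ≤ qf M (Pr h0 S y - z) := by
    intro z hz hz1
    rw [qf_Pr hlam hF]
    have hz2 : 0 ≤ z (lastIdx d h0) := hz.2
    have hs : 0 < S (lastIdx d h0) (lastIdx d h0) := hlam.trans_le hF.Sd
    have : 0 ≤ 4 * y (lastIdx d h0) * z (lastIdx d h0) / S (lastIdx d h0) (lastIdx d h0) := by
      positivity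
    linarith [hy z hz hz1]
  have hu := uu_int (h0 := h0) hR1 hv.continuousOn
  have hc1 : ContinuousAt (uu h0 R1 v) y := by
    have : uu h0 R1 v =ᶠ[𝓝 y] v := by
      filter_upwards [(Bp_open h0 R1).mem_nhds hyB] with z hz
      exact indicator_of_mem hz _
    rw [continuousAt_congr this]
    exact (diffAt_of hv ⟨ball_subset_ball hR1.le hyB.1, hyB.2⟩).continuousAt
  have he2 : uu h0 R1 v =ᶠ[𝓝 (Pr h0 S y)] fun _ => 0 := by
    have : {z : Ed d | z (lastIdx d h0) < 0} ∈ 𝓝 (Pr h0 S y) := by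
      refine (isOpen_lt (cont_coord _) continuous_const).mem_nhds ?_
      show Pr h0 S y (lastIdx d h0) < 0
      rw [Pr_last hlam hF]; linarith
    filter_upwards [this] with z hz
    refine indicator_of_notMem ?_ _
    intro h
    have h1 : 0 < z (lastIdx d h0) := h.2
    have h2 : z (lastIdx d h0) < 0 := hz
    linarith
  have hc2 : ContinuousAt (uu h0 R1 v) (Pr h0 S y) := by
    rw [continuousAt_congr he2]; exact continuousAt_const
  set m : ℝ → ℝ := fun t : ℝ => ∫ z, uu h0 R1 v z *
      ((t^d)⁻¹ * f0 (qf M (y - z)/t^2) - (t^d)⁻¹ * f0 (qf M (Pr h0 S y - z)/t^2)) with hm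
  have hsplit : ∀ s : ℝ, 0 < s → m s = (∫ z, uu h0 R1 v z * ((s^d)⁻¹ * f0 (qf M (y - z)/s^2))) -
      ∫ z, uu h0 R1 v z * ((s^d)⁻¹ * f0 (qf M (Pr h0 S y - z)/s^2)) := by
    intro s hs
    rw [← integral_sub (kern_int hu _ hs) (kern_int hu _ hs)]
    simp only [hm, mul_sub]
  have hder : ∀ s ∈ Ioo 0 T, HasDerivAt m 0 s := fun s hs =>
    mt_deriv hlam hF hR hR1 hv hb heq hy hPy hs.1 hs.2
  have hconst : ∀ s ∈ Ioo 0 T, m s = m t := fun s hs =>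
    isOpen_Ioo.is_const_of_deriv_eq_zero isPreconnected_Ioo
      (fun x hx => (hder x hx).differentiableAt.differentiableWithinAt)
      (fun x hx => (hder x hx).deriv) hs ⟨ht, htT⟩
  have hlim := (lim_kern hlam hF hu hc1).sub (lim_kern hlam hF hu hc2)
  have hlim2 : Tendsto (fun _ : ℝ => m t) atTop (𝓝 (c0 M * uu h0 R1 v y - c0 M * uu h0 R1 v (Pr h0 S y))) := by
    refine hlim.congr' ?_
    filter_upwards [eventually_gt_atTop 0, eventually_gt_atTop T⁻¹] with c hc hc2
    have hT : 0 < T := ht.trans htT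
    rw [← hsplit _ (inv_pos.2 hc)]
    exact hconst _ ⟨inv_pos.2 hc, inv_lt_of_inv_lt₀ hT hc2⟩
  have := tendsto_nhds_unique hlim2 tendsto_const_nhds
  rw [he2.eq_of_nhds, show uu h0 R1 v y = v y from indicator_of_mem hyB _, mul_zero, sub_zero] at this
  rw [this, hsplit t ht, mul_sub, ← integral_const_mul, ← integral_const_mul]
  unfold Ph
  congr 2 <;> (funext z; ring)

def cv {d : ℕ} (u g : Ed d → ℝ) (y : Ed d) : ℝ := ∫ z, u z * g (y - z)

lemma pder_comp_supp {d : ℕ} {g : Ed d → ℝ} (hg : HasCompactSupport g) (i : Fin d) :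
    HasCompactSupport (fun x => pder g i x) := by
  have h := hg.fderiv (𝕜 := ℝ)
  exact h.comp_left (g := fun L : Ed d →L[ℝ] ℝ => L (EuclideanSpace.single i 1)) (by simp)

lemma cv_pder {d : ℕ} {u g : Ed d → ℝ} (hu : Integrable u) (hg : ContDiff ℝ (⊤ : ℕ∞) g)
    (hc : HasCompactSupport g) :
    Differentiable ℝ (cv u g) ∧ ∀ i y, pder (cv u g) i y = cv u (fun x => pder g i x) y := by
  have hcv : cv u g = convolution u g (ContinuousLinearMap.mul ℝ ℝ) volume := by
    funext y; rfl
  have h1 := HasCompactSupport.hasFDerivAt_convolution_right (ContinuousLinearMap.mul ℝ ℝ)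
    (μ := (volume : Measure (Ed d))) hc hu.locallyIntegrable (hg.of_le (by simp))
  constructor
  · intro y
    rw [hcv]; exact (h1 y).differentiableAt
  · intro i y
    unfold pder
    rw [hcv, (h1 y).fderiv, convolution_precompR_apply _ hu.locallyIntegrable (hc.fderiv (𝕜 := ℝ))
      (hg.continuous_fderiv (by simp))]
    rfl

lemma Pr_add_smul {d : ℕ} (h0 : 0 < d) (S : Matrix (Fin d) (Fin d) ℝ) (x e : Ed d) (s : ℝ) :
    Pr h0 S (x + s • e) = Pr h0 S x + s • Pr h0 S e := by
  unfold Pr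
  simp only [PiLp.add_apply, PiLp.smul_apply, smul_eq_mul]
  module

lemma Pr_diff {d : ℕ} (h0 : 0 < d) (S : Matrix (Fin d) (Fin d) ℝ) : Differentiable ℝ (Pr h0 S) := by
  unfold Pr
  have : Differentiable ℝ (fun y : Ed d => y (lastIdx d h0)) :=
    (EuclideanSpace.proj (𝕜 := ℝ) (lastIdx d h0)).differentiable
  simp only [div_eq_mul_inv]
  exact differentiable_id.sub (((this.const_mul 2).mul_const _).smul_const _)

def PM {d : ℕ} (h0 : 0 < d) (S : Matrix (Fin d) (Fin d) ℝ) (k i : Fin d) : ℝ :=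
  Pr h0 S (EuclideanSpace.single i 1) k

lemma PM_bound {d : ℕ} {h0 : 0 < d} {lam : ℝ} (hlam : 0 < lam) {S M : Matrix (Fin d) (Fin d) ℝ}
    (hF : MF h0 lam S M) (k i : Fin d) : |PM h0 S k i| ≤ 1 + 2/lam := by
  have hs : 0 < S (lastIdx d h0) (lastIdx d h0) := hlam.trans_le hF.Sd
  have hone : ∀ a b : Fin d, |(EuclideanSpace.single a (1:ℝ) : Ed d) b| ≤ 1 := by
    intro a b
    by_cases h : b = a <;> simp [h]
  have e : PM h0 S k i = (EuclideanSpace.single i (1:ℝ) : Ed d) k -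
      2 * (EuclideanSpace.single i (1:ℝ) : Ed d) (lastIdx d h0) /
        S (lastIdx d h0) (lastIdx d h0) * S k (lastIdx d h0) := by
    simp [PM, Pr, nv]
  rw [e]
  refine (abs_sub _ _).trans ?_
  refine add_le_add (hone _ _) ?_
  rw [abs_mul, abs_div, abs_mul, abs_of_pos hs, abs_of_pos (two_pos : (0:ℝ) < 2)]
  calc 2 * |(EuclideanSpace.single i (1:ℝ) : Ed d) (lastIdx d h0)| /
        S (lastIdx d h0) (lastIdx d h0) * |S k (lastIdx d h0)| ≤ 2 * 1 / lam * 1 := by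
        gcongr
        · exact hone _ _
        · exact hF.Sd
        · exact hF.Sb _ _
    _ = 2/lam := by ring

lemma pder_Pr {d : ℕ} (h0 : 0 < d) (S : Matrix (Fin d) (Fin d) ℝ) {N : Ed d → ℝ}
    (hN : Differentiable ℝ N) (i : Fin d) (x : Ed d) :
    pder (fun y => N (Pr h0 S y)) i x = ∑ k, PM h0 S k i * pder N k (Pr h0 S x) := by
  have hd : DifferentiableAt ℝ (fun y => N (Pr h0 S y)) x := (hN.comp (Pr_diff h0 S)) x
  refine pder_of_line hd ?_
  simp only [Pr_add_smul]
  have h1 : HasDerivAt (fun s : ℝ => Pr h0 S x + s • Pr h0 S (EuclideanSpace.single i 1))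
      (Pr h0 S (EuclideanSpace.single i 1)) 0 := by
    have := ((hasDerivAt_id (0:ℝ)).smul_const (Pr h0 S (EuclideanSpace.single i 1))).const_add (Pr h0 S x)
    simpa using this
  have h2 : HasFDerivAt N (fderiv ℝ N (Pr h0 S x))
      (Pr h0 S x + (0:ℝ) • Pr h0 S (EuclideanSpace.single i 1)) := by
    rw [zero_smul, add_zero]; exact (hN _).hasFDerivAt
  refine (h2.comp_hasDerivAt (0:ℝ) h1).congr_deriv ?_
  have : Pr h0 S (EuclideanSpace.single i 1) = ∑ k, PM h0 S k i • EuclideanSpace.single k (1:ℝ) := by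
    ext m
    simp [PM, Pi.single_apply]
  conv_lhs => rw [this]
  rw [map_sum]
  simp [pder]

lemma pder_sum' {d : ℕ} {ι : Type*} [Fintype ι] {f : ι → Ed d → ℝ} (hf : ∀ k, Differentiable ℝ (f k))
    (c : ι → ℝ) (i : Fin d) (x : Ed d) :
    pder (fun y => ∑ k, c k * f k y) i x = ∑ k, c k * pder (f k) i x := by
  unfold pder
  rw [fderiv_fun_sum (fun k _ => ((hf k).const_mul (c k)) x)]
  simp only [sum_apply]
  refine Finset.sum_congr rfl fun k _ => ?_
  rw [fderiv_const_mul (hf k x)]; simp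

lemma pder_cmul {d : ℕ} {f : Ed d → ℝ} {x : Ed d} (hf : DifferentiableAt ℝ f x) (c : ℝ) (i : Fin d) :
    pder (fun y => c * f y) i x = c * pder f i x := by
  unfold pder
  rw [fderiv_const_mul hf]; simp

lemma hess_repr {d : ℕ} {h0 : 0 < d} {S : Matrix (Fin d) (Fin d) ℝ} {u g v : Ed d → ℝ}
    (hu : Integrable u) (hg : ContDiff ℝ (⊤ : ℕ∞) g) (hc : HasCompactSupport g) {κ : ℝ}
    {U : Set (Ed d)} (hU : IsOpen U) (h : ∀ y ∈ U, v y = κ * (cv u g y - cv u g (Pr h0 S y)))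
    {x : Ed d} (hx : x ∈ U) (i j : Fin d) :
    pder (fun y => pder v i y) j x = κ * (cv u (fun z => pder (fun w => pder g i w) j z) x -
      ∑ k, PM h0 S k i * ∑ m, PM h0 S m j *
        cv u (fun z => pder (fun w => pder g k w) m z) (Pr h0 S x)) := by
  obtain ⟨d1, p1⟩ := cv_pder hu hg hc
  have q := fun k => cv_pder hu (pder_contDiff hg k) (pder_comp_supp hc k)
  have d1P : Differentiable ℝ (fun y => cv u g (Pr h0 S y)) := d1.comp (Pr_diff h0 S)
  have qP : ∀ k, Differentiable ℝ (fun y => cv u (fun x => pder g k x) (Pr h0 S y)) := fun k =>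
    (q k).1.comp (Pr_diff h0 S)
  have s1 : ∀ y ∈ U, pder v i y = κ * (cv u (fun x => pder g i x) y -
      ∑ k, PM h0 S k i * cv u (fun x => pder g k x) (Pr h0 S y)) := by
    intro y hy
    rw [pder_congr hU h i hy, pder_cmul ((d1.fun_sub d1P) y), pder_sub (d1 y) (d1P y), p1,
      pder_Pr h0 S d1]
    simp only [p1]
  have dsum : Differentiable ℝ (fun y => ∑ k, PM h0 S k i * cv u (fun x => pder g k x) (Pr h0 S y)) :=
    Differentiable.fun_sum fun k _ => (qP k).const_mul _
  rw [pder_congr hU s1 j hx, pder_cmul (((q i).1.fun_sub dsum) x), pder_sub ((q i).1 x) (dsum x),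
    (q i).2, pder_sum' qP]
  simp only [fun k => pder_Pr h0 S (q k).1, fun k => (q k).2]

lemma pder_Ph {d : ℕ} {M : Matrix (Fin d) (Fin d) ℝ} (hM : ∀ i j, M i j = M j i) (t : ℝ)
    (k : Fin d) (x : Ed d) :
    pder (Ph M t) k x = deriv f0 (qf M x / t^2) * (-2 * mv M k (0 - x) / t^2) := by
  have hq : ∀ z : Ed d, qf M (0 - z) = qf M z := by
    intro z
    rw [show (0 : Ed d) - z = (-1 : ℝ) • z by module, qf_smul]; ring
  have e : Ph M t = fun z => f0 (qf M (0 - z) / t^2) := by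
    funext z; simp only [Ph, hq]
  rw [e, pder_comp1 (f0_diff _).hasDerivAt ((Q_contDiff M t 0).differentiable (by simp) _),
    pder_Q hM, hq]

lemma pder_Ph_zero {d : ℕ} {M : Matrix (Fin d) (Fin d) ℝ} (hM : ∀ i j, M i j = M j i) {t : ℝ}
    (ht : 0 < t) (k : Fin d) {x : Ed d} (hx : t^2 ≤ qf M x) : pder (Ph M t) k x = 0 := by
  rw [pder_Ph hM, df0_zero, zero_mul]
  rw [le_div_iff₀ (by positivity)]; linarith

lemma pder2_Ph_zero {d : ℕ} {M : Matrix (Fin d) (Fin d) ℝ} (hM : ∀ i j, M i j = M j i) {t : ℝ}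
    (ht : 0 < t) (k m : Fin d) {x : Ed d} (hx : t^2 < qf M x) :
    pder (fun w => pder (Ph M t) k w) m x = 0 := by
  have hU : IsOpen {x : Ed d | t^2 < qf M x} :=
    isOpen_lt continuous_const (qf_contDiff M).continuous
  rw [pder_congr hU (g := fun _ => 0) (fun z hz => pder_Ph_zero hM ht k (le_of_lt hz)) m hx]
  simp [pder]

lemma pder_Ph_bound {d : ℕ} {h0 : 0 < d} {lam : ℝ} (hlam : 0 < lam) {S M : Matrix (Fin d) (Fin d) ℝ}
    (hF : MF h0 lam S M) {C : ℝ} (hC : ∀ s, |deriv f0 s| ≤ C) {t : ℝ} (ht : 0 < t)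
    (k : Fin d) (x : Ed d) :
    |pder (Ph M t) k x| ≤ C * (2 * d / Real.sqrt lam / lam) / t := by
  have hC0 : 0 ≤ C := (abs_nonneg _).trans (hC 0)
  have hsl := Real.sqrt_pos.2 hlam
  by_cases hx : t^2 ≤ qf M x
  · rw [pder_Ph_zero hF.Ms ht k hx, abs_zero]; positivity
  · push Not at hx
    have h1 := qf_small hlam hF ht (x := x) (by rw [div_lt_one (by positivity)]; exact hx)
    have h2 : |mv M k (0 - x)| ≤ ‖x‖/lam := by
      have := hF.Mb (0 - x) k
      rwa [zero_sub, norm_neg, ← zero_sub] at this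
    rw [pder_Ph hF.Ms, abs_mul, abs_div, abs_mul, abs_of_pos (by positivity : 0 < t^2)]
    calc |deriv f0 (qf M x / t^2)| * (|(-2:ℝ)| * |mv M k (0 - x)| / t^2)
        ≤ C * (2 * ((t * d / Real.sqrt lam)/lam) / t^2) := by
          have h3 : |mv M k (0 - x)| ≤ (t * d / Real.sqrt lam)/lam := h2.trans (by gcongr)
          rw [show |(-2:ℝ)| = 2 by norm_num]
          gcongr
          exact hC _
      _ = C * (2 * d / Real.sqrt lam / lam) / t := by field_simp

lemma pder_refl {d : ℕ} {g : Ed d → ℝ} (hg : Differentiable ℝ g) (m : Fin d) (y z : Ed d) :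
    pder (fun w => g (y - w)) m z = - pder g m (y - z) := by
  unfold pder
  have h1 : HasFDerivAt (fun w : Ed d => y - w) (-(ContinuousLinearMap.id ℝ (Ed d))) z :=
    (hasFDerivAt_id z).const_sub y
  have h2 := (hg (y - z)).hasFDerivAt.comp z h1
  have h3 : fderiv ℝ (fun w => g (y - w)) z = _ := h2.fderiv
  rw [h3]
  simp

lemma grad_L1 {d : ℕ} {h0 : 0 < d} {R : ℝ} (hR : 0 < R) {v : Ed d → ℝ}
    (hv : ContDiffOn ℝ (⊤ : ℕ∞) v (Bpc d h0 R))
    (hi : IntegrableOn (fun y => norm2v (gradv v y)) (Bp d h0 R)) :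
    IntegrableOn (fun y => Real.sqrt (norm2v (gradv v y))) (Bp d h0 R) ∧
    (∫ y in Bp d h0 R, Real.sqrt (norm2v (gradv v y)))^2 ≤
      (volume.real (Bp d h0 R))^2 * ⨍ y in Bp d h0 R, norm2v (gradv v y) := by
  have hfin : volume (Bp d h0 R) ≠ ⊤ :=
    ((measure_mono inter_subset_left).trans_lt (measure_ball_lt_top (x := (0 : Ed d)) (r := R))).ne
  have : IsFiniteMeasure (volume.restrict (Bp d h0 R)) := ⟨by
    rw [Measure.restrict_apply_univ]; exact hfin.lt_top⟩
  have hi1 : IntegrableOn (fun y => Real.sqrt (norm2v (gradv v y))) (Bp d h0 R) := by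
    refine Integrable.mono' (g := fun y => 1 + norm2v (gradv v y)) ((integrable_const _).add hi)
      (Real.continuous_sqrt.comp_aestronglyMeasurable hi.aestronglyMeasurable) ?_
    refine Eventually.of_forall fun y => ?_
    rw [Real.norm_of_nonneg (Real.sqrt_nonneg _)]
    have h1 := Real.sq_sqrt (norm2v_nonneg (gradv v y))
    nlinarith [sq_nonneg (Real.sqrt (norm2v (gradv v y)) - 1), Real.sqrt_nonneg (norm2v (gradv v y))]
  refine ⟨hi1, ?_⟩
  set II := ∫ y in Bp d h0 R, Real.sqrt (norm2v (gradv v y)) with hI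
  set J := ∫ y in Bp d h0 R, norm2v (gradv v y) with hJ
  set V := volume.real (Bp d h0 R) with hV
  have hVpos : 0 < V := ENNReal.toReal_pos ((Bp_open h0 R).measure_pos _ (Bp_nonempty h0 hR)).ne' hfin
  rw [setAverage_eq, smul_eq_mul, ← hJ, ← hV]
  have hkey : 0 ≤ V^2 * J - V * II^2 := by
    have hnn : 0 ≤ ∫ y in Bp d h0 R, (V^2 * norm2v (gradv v y) -
        2 * V * II * Real.sqrt (norm2v (gradv v y)) + II^2) := by
      refine integral_nonneg fun y => ?_
      have h1 := Real.sq_sqrt (norm2v_nonneg (gradv v y))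
      show 0 ≤ V^2 * norm2v (gradv v y) - 2 * V * II * Real.sqrt (norm2v (gradv v y)) + II^2
      nlinarith [sq_nonneg (V * Real.sqrt (norm2v (gradv v y)) - II)]
    have i1 := hi.const_mul (V^2)
    have i2 := hi1.const_mul (2 * V * II)
    have e1 : ∫ y in Bp d h0 R, (V^2 * norm2v (gradv v y) -
        2 * V * II * Real.sqrt (norm2v (gradv v y)) + II^2) =
        V^2 * J - 2 * V * II * II + V * II^2 := by
      rw [integral_add (f := fun y => V^2 * norm2v (gradv v y) -
        2 * V * II * Real.sqrt (norm2v (gradv v y))) (i1.sub i2) (integrable_const _),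
        integral_sub i1 i2, integral_const_mul, integral_const_mul, setIntegral_const, smul_eq_mul]
    rw [e1] at hnn
    nlinarith
  have : 0 ≤ V * (V * J - II^2) := by nlinarith
  have h3 := nonneg_of_mul_nonneg_right this hVpos
  have e : V^2 * (V⁻¹ * J) = V * J := by field_simp
  rw [e]; linarith

lemma cv_bound {d : ℕ} {h0 : 0 < d} {lam : ℝ} (hlam : 0 < lam) {S M : Matrix (Fin d) (Fin d) ℝ}
    (hF : MF h0 lam S M) {R R1 T : ℝ} (hR : 0 < R) (hR1 : R1 < R) {v : Ed d → ℝ}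
    (hv : ContDiffOn ℝ (⊤ : ℕ∞) v (Bpc d h0 R))
    (hb : ∀ x ∈ ball (0 : Ed d) R, x (lastIdx d h0) = 0 → v x = 0)
    (hi1 : IntegrableOn (fun y => Real.sqrt (norm2v (gradv v y))) (Bp d h0 R))
    {y : Ed d} (hy : ∀ z ∈ Bpc d h0 R, R1 ≤ ‖z‖ → T^2 ≤ qf M (y - z))
    {C : ℝ} (hC : ∀ s, |deriv f0 s| ≤ C)
    {t : ℝ} (ht : 0 < t) (htT : t < T) (k m : Fin d) :
    |cv (uu h0 R1 v) (fun z => pder (fun w => pder (Ph M t) k w) m z) y| ≤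
      C * (2 * d / Real.sqrt lam / lam) / t * ∫ y in Bp d h0 R, Real.sqrt (norm2v (gradv v y)) := by
  have hT : ∀ z ∈ Bpc d h0 R, R1 ≤ ‖z‖ → t^2 < qf M (y - z) := by
    intro z hz hz1
    have := hy z hz hz1
    nlinarith
  have hsm := pder_contDiff (Ph_contDiff M t) k
  unfold cv
  rw [uu_mul hR1 (fun z hz hz1 => pder2_Ph_zero hF.Ms ht k m (hT z hz hz1))]
  have hib := ibp h0 hR hR1 (v := v) (η := fun z => pder (Ph M t) k (y - z)) hv hb
    (hsm.comp (contDiff_const.sub contDiff_id))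
    (fun z hz hz1 => pder_Ph_zero hF.Ms ht k (hT z hz hz1.le).le) m
  have e : ∀ z, pder (fun z => pder (Ph M t) k (y - z)) m z =
      - pder (fun w => pder (Ph M t) k w) m (y - z) := fun z =>
    pder_refl (hsm.differentiable (by simp)) m y z
  simp only [e, mul_neg, integral_neg, neg_inj] at hib
  rw [hib, ← integral_const_mul]
  rw [← Real.norm_eq_abs]
  refine norm_integral_le_of_norm_le (hi1.const_mul _) ?_
  refine Eventually.of_forall fun z => ?_
  rw [norm_mul, Real.norm_eq_abs, Real.norm_eq_abs, mul_comm]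
  have h1 := pder_Ph_bound hlam hF hC ht k (y - z)
  have h2 : |pder v m z| ≤ Real.sqrt (norm2v (gradv v z)) :=
    Real.abs_le_sqrt (sq_le_norm2v (gradv v z) m)
  exact mul_le_mul h1 h2 (abs_nonneg _) ((abs_nonneg _).trans h1)

lemma hess_bound {d : ℕ} {h0 : 0 < d} {lam : ℝ} (hlam : 0 < lam) {S M : Matrix (Fin d) (Fin d) ℝ}
    (hF : MF h0 lam S M) {R : ℝ} (hR : 0 < R) {v : Ed d → ℝ}
    (hv : ContDiffOn ℝ (⊤ : ℕ∞) v (Bpc d h0 R))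
    (hb : ∀ x ∈ ball (0 : Ed d) R, x (lastIdx d h0) = 0 → v x = 0)
    (heq : ∀ x ∈ Bp d h0 R, ∑ i, ∑ j, S i j * pder (fun y => pder v j y) i x = 0)
    (hi1 : IntegrableOn (fun y => Real.sqrt (norm2v (gradv v y))) (Bp d h0 R))
    {C : ℝ} (hC : ∀ s, |deriv f0 s| ≤ C) {x : Ed d} (hx : x ∈ Bp d h0 (R/2)) {τ : ℝ}
    (hτ : τ = Real.sqrt lam / (16 * d)) (i j : Fin d) :
    |pder (fun y => pder v i y) j x| ≤
      (volume.real (ball (0 : Ed d) (Real.sqrt (lam/2))))⁻¹ * ((τ * R)^d)⁻¹ *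
      ((1 + d * (1 + 2/lam) * (d * (1 + 2/lam))) * (C * (2 * d / Real.sqrt lam / lam) / (τ * R) *
        ∫ y in Bp d h0 R, Real.sqrt (norm2v (gradv v y)))) := by
  have hd : (0:ℝ) < d := by exact_mod_cast h0
  have hsl := Real.sqrt_pos.2 hlam
  have hτ0 : 0 < τ := by rw [hτ]; positivity
  set t := τ * R with htdef
  have ht : 0 < t := by positivity
  have hR1 : 3*R/4 < R := by linarith
  have far : ∀ y ∈ Bp d h0 (5*R/8), ∀ z ∈ Bpc d h0 R, 3*R/4 ≤ ‖z‖ → (2*t)^2 ≤ qf M (y - z) := by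
    intro y hy z _ hz
    have hyn : ‖y‖ < 5*R/8 := by simpa using hy.1
    have h1 : R/8 ≤ ‖y - z‖ := by
      have := norm_sub_norm_le z y
      rw [norm_sub_rev] at this
      linarith
    refine le_trans ?_ (hF.qlow (y - z))
    calc (2*t)^2 = lam/d^2 * (R/8)^2 := by
          rw [htdef, hτ]
          have : Real.sqrt lam ^2 = lam := Real.sq_sqrt hlam.le
          rw [show (2 * (Real.sqrt lam/(16*d) * R))^2 = Real.sqrt lam ^2 * (2/(16*d)*R)^2 by ring, this]
          field_simp
          norm_num
      _ ≤ lam/d^2 * ‖y - z‖^2 := by gcongr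
  have hxU : x ∈ Bp d h0 (5*R/8) := ⟨ball_subset_ball (by linarith) hx.1, hx.2⟩
  have farP : ∀ z ∈ Bpc d h0 R, 3*R/4 ≤ ‖z‖ → (2*t)^2 ≤ qf M (Pr h0 S x - z) := by
    intro z hz hz1
    rw [qf_Pr hlam hF]
    have hz2 : 0 ≤ z (lastIdx d h0) := hz.2
    have hx2 : 0 < x (lastIdx d h0) := hx.2
    have hs : 0 < S (lastIdx d h0) (lastIdx d h0) := hlam.trans_le hF.Sd
    have : 0 ≤ 4 * x (lastIdx d h0) * z (lastIdx d h0) / S (lastIdx d h0) (lastIdx d h0) := by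
      positivity
    linarith [far x hxU z hz hz1]
  have hw := vball_pos (d := d) hlam
  have hwc := c0_low hlam hF
  have hc0 : 0 < c0 M := hw.trans_le hwc
  set w := volume.real (ball (0 : Ed d) (Real.sqrt (lam/2)))
  have hrep : ∀ y ∈ Bp d h0 (5*R/8), v y = ((c0 M)⁻¹ * (t^d)⁻¹) *
      (cv (uu h0 (3*R/4) v) (Ph M t) y - cv (uu h0 (3*R/4) v) (Ph M t) (Pr h0 S y)) := by
    intro y hy
    have := repr hlam hF hR hR1 hv hb heq (y := y) (T := 2*t)
      ⟨ball_subset_ball (by linarith) hy.1, hy.2⟩ (far y hy) ht (by linarith)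
    unfold cv
    rw [mul_assoc, ← this]
    field_simp
  have hu := uu_int (h0 := h0) hR1 hv.continuousOn
  rw [hess_repr hu (Ph_contDiff M t) (Ph_comp hlam hF ht) (Bp_open h0 _) hrep hxU i j]
  set B := C * (2 * d / Real.sqrt lam / lam) / t * ∫ y in Bp d h0 R, Real.sqrt (norm2v (gradv v y))
    with hBdef
  have b1 := cv_bound hlam hF hR hR1 hv hb hi1 (far x hxU) hC ht (by linarith : t < 2*t)
  have b2 := cv_bound hlam hF hR hR1 hv hb hi1 farP hC ht (by linarith : t < 2*t)
  rw [← hBdef] at b1 b2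
  have hB : 0 ≤ B := (abs_nonneg _).trans (b1 i i)
  have hp := PM_bound hlam hF
  set p := 1 + 2/lam
  have hp0 : 0 ≤ p := (abs_nonneg _).trans (hp i i)
  rw [abs_mul, abs_of_pos (by positivity : 0 < (c0 M)⁻¹ * (t^d)⁻¹)]
  refine mul_le_mul (by gcongr) ?_ (abs_nonneg _) (by positivity)
  refine (abs_sub _ _).trans ?_
  rw [add_mul, one_mul]
  refine add_le_add (b1 i j) ?_
  refine (Finset.abs_sum_le_sum_abs _ _).trans ?_
  calc _ ≤ ∑ k : Fin d, p * (d * p * B) := by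
        refine Finset.sum_le_sum fun k _ => ?_
        rw [abs_mul]
        refine mul_le_mul (hp _ _) ?_ (abs_nonneg _) hp0
        refine (Finset.abs_sum_le_sum_abs _ _).trans ?_
        calc _ ≤ ∑ m : Fin d, p * B := by
              refine Finset.sum_le_sum fun m _ => ?_
              rw [abs_mul]
              exact mul_le_mul (hp _ _) (b2 k m) (abs_nonneg _) hp0
          _ = d * p * B := by simp; ring
    _ = d * p * (d * p) * B := by simp; ring

/-- **Lemma 4.2 (a)**: interior second-derivative estimate for constant-coefficient
solutions on half-balls with vanishing Dirichlet data on the flat boundary portion. -/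
theorem constant_coefficient_hessian_estimate
    (d : ℕ) (h0 : 0 < d) (hd : 2 ≤ d) (lam : ℝ) (hlam0 : 0 < lam) (hlam1 : lam ≤ 1) :
    ∃ Cst : ℝ, 0 < Cst ∧
    ∀ (A : Matrix (Fin d) (Fin d) ℝ), MatElliptic A lam →
    ∀ (R' : ℝ), 0 < R' →
    ∀ (v : Ed d → ℝ),
      ContDiffOn ℝ (⊤ : ℕ∞) v (Bpc d h0 R') →
      (∀ x ∈ ball (0 : Ed d) R', x (lastIdx d h0) = 0 → v x = 0) →
      (∀ ζ : Ed d → ℝ, IsTest (Bp d h0 R') ζ →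
        ∫ x in Bp d h0 R', dotv (A.mulVec (gradv v x)) (gradv ζ x) = 0) →
      IntegrableOn (fun y => norm2v (gradv v y)) (Bp d h0 R') →
    ∀ r : ℝ, 0 < r → r ≤ R'/2 → ∀ x ∈ Bp d h0 r,
      r^2 * (∑ i, ∑ j, (pder (fun y => pder v i y) j x)^2)
        ≤ Cst * (r/R')^2 * ⨍ y in Bp d h0 R', norm2v (gradv v y) := by
  obtain ⟨C, hC0, hC⟩ := df0_bound
  have hdp : (0:ℝ) < d := by exact_mod_cast h0
  have hsl := Real.sqrt_pos.2 hlam0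
  set τ := Real.sqrt lam / (16 * d) with hτ
  have hτ0 : 0 < τ := by positivity
  set w := volume.real (ball (0 : Ed d) (Real.sqrt (lam/2))) with hw
  have hw0 : 0 < w := vball_pos hlam0
  set ω := volume.real (ball (0 : Ed d) 1) with hω
  have hω0 : 0 < ω := ENNReal.toReal_pos (measure_ball_pos _ _ one_pos).ne' measure_ball_lt_top.ne
  set K := w⁻¹ * (τ^d)⁻¹ *
      ((1 + d * (1 + 2/lam) * (d * (1 + 2/lam))) * (C * (2 * d / Real.sqrt lam / lam) / τ)) * ω with hK
  have hK0 : 0 < K := by positivity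
  refine ⟨d * d * K^2, by positivity, ?_⟩
  intro A hA R hR v hv hb hweak hi r hr hrR x hx
  obtain ⟨S, M, hF, hS⟩ := mat_facts h0 hlam0 hA
  have heq : ∀ x ∈ Bp d h0 R, ∑ i, ∑ j, S i j * pder (fun y => pder v j y) i x = 0 := fun x hx =>
    strong_eq_S h0 hR hS hv hweak hx
  obtain ⟨hi1, hG⟩ := grad_L1 hR hv hi
  set G := ∫ y in Bp d h0 R, Real.sqrt (norm2v (gradv v y)) with hGdef
  set E := ⨍ y in Bp d h0 R, norm2v (gradv v y) with hE
  have hG0 : 0 ≤ G := integral_nonneg fun y => Real.sqrt_nonneg _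
  have hE0 : 0 ≤ E := by
    rw [hE, setAverage_eq]
    exact smul_nonneg (by positivity) (integral_nonneg fun y => norm2v_nonneg _)
  have hvol : volume.real (Bp d h0 R) ≤ R^d * ω := by
    have h1 : volume.real (Bp d h0 R) ≤ volume.real (ball (0 : Ed d) R) :=
      measureReal_mono inter_subset_left measure_ball_lt_top.ne
    have h2 : volume.real (ball (0 : Ed d) R) = R^d * ω := by
      rw [hω, Measure.real, Measure.real, Measure.addHaar_ball_of_pos _ _ hR]
      simp [ENNReal.toReal_mul, hR.le]
    linarith
  have hG2 : G^2 ≤ (R^d * ω)^2 * E := hG.trans (by gcongr)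
  have hxR : x ∈ Bp d h0 (R/2) := ⟨ball_subset_ball hrR hx.1, hx.2⟩
  have hij : ∀ i j, (pder (fun y => pder v i y) j x)^2 ≤ K^2 / R^2 * E := by
    intro i j
    have h1 := hess_bound hlam0 hF hR hv hb heq hi1 hC hxR hτ i j
    rw [← hw, ← hGdef] at h1
    have h2 : w⁻¹ * ((τ * R)^d)⁻¹ *
      ((1 + d * (1 + 2/lam) * (d * (1 + 2/lam))) * (C * (2 * d / Real.sqrt lam / lam) / (τ * R) * G))
      = K / (R * (R^d * ω)) * G := by
      rw [hK, mul_pow]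
      field_simp
    rw [h2] at h1
    rw [← sq_abs]
    calc |pder (fun y => pder v i y) j x|^2 ≤ (K / (R * (R^d * ω)) * G)^2 := by gcongr
      _ = (K / (R * (R^d * ω)))^2 * G^2 := by ring
      _ ≤ (K / (R * (R^d * ω)))^2 * ((R^d * ω)^2 * E) := by gcongr
      _ = K^2 / R^2 * E := by field_simp
  calc r^2 * (∑ i, ∑ j, (pder (fun y => pder v i y) j x)^2)
      ≤ r^2 * (∑ i : Fin d, ∑ j : Fin d, K^2 / R^2 * E) := by
        gcongr with i _ j _
        exact hij i j
    _ = d * d * K^2 * (r/R)^2 * E := by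
        simp; field_simp

end HS
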